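/- arXiv:0904.2094 — 4 statements merged into one kernel-verified Lean document; each statement's English description precedes it below -/
import Mathlib

section
/- Let (G_n)_{n≥1} be a sequence of real random variables on a probability space converging in distribution to a random variable G_∞. For t ∈ ℝ and n ≥ 2 set Δ_n(t) = (1/log n) Σ_{k=1}^n (1/k)(e^{itG_k} − E[e^{itG_∞}]). If for every r > 0 one has sup_{|t|≤r} Σ_{n≥2} E[|Δ_n(t)|²]/(n log n) < ∞, then almost surely, for every bounded continuous function φ : ℝ → ℝ, (1/log n) Σ_{k=1}^n (1/k) φ(G_k) → E[φ(G_∞)] as n → ∞. -/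
open MeasureTheory Filter Topology

/-- the weights `1/(n log n)`. -/
noncomputable def wgt (n : ℕ) : ℝ := ((n : ℝ) * Real.log n)⁻¹

lemma wgt_nonneg (n : ℕ) : 0 ≤ wgt n := by
  unfold wgt
  have := Real.log_natCast_nonneg n
  positivity

lemma wgt_anti {n : ℕ} (hn : 2 ≤ n) : wgt (n + 1) ≤ wgt n := by
  unfold wgt
  have h2 : (2 : ℝ) ≤ n := by exact_mod_cast hn
  have h0 : 0 < Real.log n := Real.log_pos (by linarith)
  have h1 : Real.log n ≤ Real.log (n + 1 : ℕ) := Real.log_le_log (by linarith) (by push_cast; linarith)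
  gcongr
  linarith

lemma not_summable_wgt : ¬ Summable wgt := by
  rw [← summable_condensed_iff_of_eventually_nonneg (Eventually.of_forall wgt_nonneg)
    (by filter_upwards [eventually_ge_atTop 2] with n hn using wgt_anti hn)]
  intro h
  have h2 : (fun k : ℕ => (2 : ℝ) ^ k * wgt (2 ^ k)) = fun k : ℕ => (Real.log 2)⁻¹ * (k : ℝ)⁻¹ := by
    funext k
    simp only [wgt, Nat.cast_pow, Nat.cast_ofNat, Real.log_pow, mul_inv]
    have : (2 : ℝ) ^ k ≠ 0 := by positivity
    field_simp
  rw [h2, summable_mul_left_iff (by have := Real.log_pos (one_lt_two); positivity)] at h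
  exact Real.not_summable_natCast_inv h

lemma tendsto_zero_of_slow (u : ℕ → ℝ) (hu : ∀ n, 0 ≤ u n) (C : ℝ)
    (hd : ∀ n, 2 ≤ n → |u (n + 1) - u n| ≤ C * wgt (n + 1))
    (hs : Summable fun n => u n ^ 2 * wgt n) : Tendsto u atTop (𝓝 0) := by
  have hC : 0 ≤ C ∨ C < 0 := le_or_gt 0 C
  wlog hC0 : 0 ≤ C generalizing C
  · refine this (|C|) (fun n hn => (hd n hn).trans ?_) (Or.inl (abs_nonneg _)) (abs_nonneg _)
    exact mul_le_mul_of_nonneg_right (le_abs_self C) (wgt_nonneg _)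
  have hs1 : Summable fun n => u (n + 1) ^ 2 * wgt (n + 1) :=
    (summable_nat_add_iff (f := fun n => u n ^ 2 * wgt n) 1).2 hs
  have hdist : Summable fun n => dist (u n ^ 3) (u (n + 1) ^ 3) := by
    refine Summable.of_norm_bounded_eventually_nat
      (g := fun n => C * (2 * (u (n + 1) ^ 2 * wgt (n + 1) + u n ^ 2 * wgt n)))
      (((hs1.add hs).mul_left 2).mul_left C) ?_
    filter_upwards [eventually_ge_atTop 2] with n hn
    rw [Real.norm_of_nonneg dist_nonneg, dist_comm, Real.dist_eq]
    have e : u (n + 1) ^ 3 - u n ^ 3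
      = (u (n + 1) - u n) * (u (n + 1) ^ 2 + u (n + 1) * u n + u n ^ 2) := by ring
    have h0 : 0 ≤ u (n + 1) ^ 2 + u (n + 1) * u n + u n ^ 2 := by
      have := hu n; have := hu (n + 1); positivity
    rw [e, abs_mul, abs_of_nonneg h0]
    have h1 : u (n + 1) ^ 2 + u (n + 1) * u n + u n ^ 2 ≤ 2 * (u (n + 1) ^ 2 + u n ^ 2) := by
      nlinarith [sq_nonneg (u (n + 1) - u n)]
    calc |u (n + 1) - u n| * (u (n + 1) ^ 2 + u (n + 1) * u n + u n ^ 2)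
        ≤ (C * wgt (n + 1)) * (2 * (u (n + 1) ^ 2 + u n ^ 2)) := by
          apply mul_le_mul (hd n hn) h1 h0
          exact mul_nonneg hC0 (wgt_nonneg _)
      _ = C * (2 * (u (n + 1) ^ 2 * wgt (n + 1) + u n ^ 2 * wgt (n + 1))) := by ring
      _ ≤ _ := by
          have := wgt_anti hn
          gcongr
  obtain ⟨L, hL⟩ := cauchySeq_tendsto_of_complete (cauchySeq_of_summable_dist hdist)
  have hL0 : 0 ≤ L := ge_of_tendsto' hL fun n => pow_nonneg (hu n) 3
  have hu' : Tendsto u atTop (𝓝 (L ^ (1 / 3 : ℝ))) := by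
    have := hL.rpow_const (p := (1 / 3 : ℝ)) (Or.inr (by norm_num))
    refine this.congr fun n => ?_
    rw [← Real.rpow_natCast, ← Real.rpow_mul (hu n)]
    norm_num
  rcases hL0.eq_or_lt with h | h
  · rw [← h] at hu'
    simpa using hu'
  exfalso
  have hl : 0 < L ^ (1 / 3 : ℝ) := by positivity
  set l := L ^ (1 / 3 : ℝ)
  apply not_summable_wgt
  refine Summable.of_norm_bounded_eventually_nat
    (g := fun n => (l / 2) ^ (-2 : ℤ) * (u n ^ 2 * wgt n)) (hs.mul_left _) ?_
  filter_upwards [hu'.eventually (lt_mem_nhds (half_lt_self hl))] with n hn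
  rw [Real.norm_of_nonneg (wgt_nonneg n), ← mul_assoc]
  apply le_mul_of_one_le_left (wgt_nonneg n)
  rw [zpow_neg, inv_mul_eq_div, one_le_div (by positivity)]
  have : (l / 2) ^ 2 ≤ u n ^ 2 := by gcongr
  exact_mod_cast this

lemma sum_inv_le (n : ℕ) : ∑ k ∈ Finset.Icc 1 n, (k : ℝ)⁻¹ ≤ 1 + Real.log n := by
  have := harmonic_le_one_add_log n
  rw [harmonic_eq_sum_Icc] at this
  push_cast at this
  exact this

lemma le_sum_inv (n : ℕ) : Real.log (n + 1) ≤ ∑ k ∈ Finset.Icc 1 n, (k : ℝ)⁻¹ := by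
  have := log_add_one_le_harmonic n
  rw [harmonic_eq_sum_Icc] at this
  push_cast at this
  exact_mod_cast this

lemma tendsto_sum_inv_div_log :
    Tendsto (fun n : ℕ => (Real.log n)⁻¹ * ∑ k ∈ Finset.Icc 1 n, (k : ℝ)⁻¹) atTop (𝓝 1) := by
  have hlog : Tendsto (fun n : ℕ => Real.log n) atTop atTop :=
    Real.tendsto_log_atTop.comp tendsto_natCast_atTop_atTop
  have h1 : Tendsto (fun n : ℕ => (Real.log n)⁻¹ + 1) atTop (𝓝 1) := by
    simpa using hlog.inv_tendsto_atTop.add_const 1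
  refine tendsto_of_tendsto_of_tendsto_of_le_of_le' tendsto_const_nhds h1 ?_ ?_
  · filter_upwards [eventually_ge_atTop 2] with n hn
    have h2 : (2 : ℝ) ≤ n := by exact_mod_cast hn
    have h0 : 0 < Real.log n := Real.log_pos (by linarith)
    rw [inv_mul_eq_div, one_le_div h0]
    exact (Real.log_le_log (by linarith) (by linarith)).trans (le_sum_inv n)
  · filter_upwards [eventually_ge_atTop 2] with n hn
    have h2 : (2 : ℝ) ≤ n := by exact_mod_cast hn
    have h0 : 0 < Real.log n := Real.log_pos (by linarith)
    calc _ ≤ (Real.log n)⁻¹ * (1 + Real.log n) := by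
          gcongr
          exact sum_inv_le n
      _ = _ := by field_simp

lemma log_avg_tendsto (a : ℕ → ℂ) (ha : ∀ k, ‖a k‖ ≤ 2) (D : ℕ → ℂ)
    (hD : ∀ n, D n = (Real.log n)⁻¹ • ∑ k ∈ Finset.Icc 1 n, (k : ℂ)⁻¹ * a k)
    (hs : Summable fun n => ‖D n‖ ^ 2 * wgt n) : Tendsto D atTop (𝓝 0) := by
  rw [tendsto_zero_iff_norm_tendsto_zero]
  refine tendsto_zero_of_slow _ (fun _ => norm_nonneg _) 14 (fun n hn => ?_) hs
  refine (abs_norm_sub_norm_le _ _).trans ?_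
  have h2 : (2 : ℝ) ≤ n := by exact_mod_cast hn
  have hl2 : (1 / 2 : ℝ) ≤ Real.log 2 := by have := Real.log_two_gt_d9; linarith
  have hln : (1 / 2 : ℝ) ≤ Real.log n := hl2.trans (Real.log_le_log (by norm_num) h2)
  have hln1 : Real.log n ≤ Real.log ((n + 1 : ℕ) : ℝ) :=
    Real.log_le_log (by linarith) (by push_cast; linarith)
  set S := ∑ k ∈ Finset.Icc 1 n, (k : ℂ)⁻¹ * a k with hS
  have hSn : ‖S‖ ≤ 6 * Real.log n := by
    calc ‖S‖ ≤ ∑ k ∈ Finset.Icc 1 n, (k : ℝ)⁻¹ * 2 := by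
          refine norm_sum_le_of_le _ fun k _ => ?_
          rw [norm_mul, norm_inv, Complex.norm_natCast]
          gcongr
          exact ha k
      _ = 2 * ∑ k ∈ Finset.Icc 1 n, (k : ℝ)⁻¹ := by rw [← Finset.sum_mul, mul_comm]
      _ ≤ 2 * (1 + Real.log n) := by gcongr; exact sum_inv_le n
      _ ≤ _ := by linarith
  have hdl : Real.log ((n + 1 : ℕ) : ℝ) - Real.log n ≤ (n : ℝ)⁻¹ := by
    rw [← Real.log_div (by positivity) (by positivity)]
    refine (Real.log_le_sub_one_of_pos (by positivity)).trans (le_of_eq ?_)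
    push_cast
    field_simp
    ring
  rw [hD, hD, Finset.sum_Icc_succ_top (by omega), ← hS]
  set l := Real.log n
  set m := Real.log ((n + 1 : ℕ) : ℝ)
  have hl : 0 < l := by linarith
  have hm : 0 < m := by linarith
  have e : m⁻¹ • (S + ((n + 1 : ℕ) : ℂ)⁻¹ * a (n + 1)) - l⁻¹ • S
     = m⁻¹ • (((n + 1 : ℕ) : ℂ)⁻¹ * a (n + 1)) - (l⁻¹ - m⁻¹) • S := by
    simp only [smul_add, sub_smul]; ring
  rw [e]
  have hw : wgt (n + 1) = ((n : ℝ) + 1)⁻¹ * m⁻¹ := by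
    simp only [wgt, mul_inv]; push_cast; simp [m]
  refine (norm_sub_le _ _).trans ?_
  have b1 : ‖m⁻¹ • (((n + 1 : ℕ) : ℂ)⁻¹ * a (n + 1))‖ ≤ 2 * wgt (n + 1) := by
    rw [norm_smul, norm_mul, norm_inv, norm_inv, Complex.norm_natCast, Real.norm_of_nonneg hm.le, hw]
    calc m⁻¹ * (((n + 1 : ℕ) : ℝ)⁻¹ * ‖a (n + 1)‖) ≤ m⁻¹ * (((n + 1 : ℕ) : ℝ)⁻¹ * 2) := by
          gcongr; exact ha _
      _ = _ := by push_cast; ring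
  have b2 : ‖(l⁻¹ - m⁻¹) • S‖ ≤ 12 * wgt (n + 1) := by
    have h3 : 0 ≤ l⁻¹ - m⁻¹ := sub_nonneg.2 (inv_anti₀ hl hln1)
    have h4 : l⁻¹ - m⁻¹ = (m - l) * (l⁻¹ * m⁻¹) := by field_simp
    rw [norm_smul, Real.norm_of_nonneg h3, hw]
    calc (l⁻¹ - m⁻¹) * ‖S‖ ≤ (l⁻¹ - m⁻¹) * (6 * l) := by gcongr
      _ = (m - l) * (6 * m⁻¹) := by rw [h4]; field_simp
      _ ≤ (n : ℝ)⁻¹ * (6 * m⁻¹) := by gcongr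
      _ ≤ (2 * ((n : ℝ) + 1)⁻¹) * (6 * m⁻¹) := by
          gcongr
          rw [← div_eq_mul_inv, le_div_iff₀ (by positivity)]
          field_simp
          linarith
      _ = _ := by ring
  linarith

lemma exists_prob (x : ℕ → ℝ) (n : ℕ) : ∃ ν : ProbabilityMeasure ℝ,
    (∀ f : ℝ → ℝ, ∫ y, f y ∂(ν : Measure ℝ) = (∑ k ∈ Finset.Icc 1 (n + 1), (k : ℝ)⁻¹)⁻¹ *
      ∑ k ∈ Finset.Icc 1 (n + 1), (k : ℝ)⁻¹ * f (x k)) ∧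
    (∀ f : ℝ → ℂ, ∫ y, f y ∂(ν : Measure ℝ) = ((∑ k ∈ Finset.Icc 1 (n + 1), (k : ℝ)⁻¹)⁻¹ : ℝ) •
      ∑ k ∈ Finset.Icc 1 (n + 1), (k : ℂ)⁻¹ * f (x k)) := by
  set H := ∑ k ∈ Finset.Icc 1 (n + 1), (k : ℝ)⁻¹ with hH
  have hHpos : 0 < H := by
    refine Finset.sum_pos (fun k hk => ?_) ⟨1, by simp⟩
    have : 0 < k := by simp at hk; omega
    positivity
  set M : Measure ℝ := ENNReal.ofReal H⁻¹ •
    ∑ k ∈ Finset.Icc 1 (n + 1), ENNReal.ofReal (k : ℝ)⁻¹ • Measure.dirac (x k) with hM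
  have hprob : IsProbabilityMeasure M := by
    constructor
    simp only [hM, Measure.smul_apply, Measure.finsetSum_apply, smul_eq_mul, measure_univ, mul_one]
    rw [← ENNReal.ofReal_sum_of_nonneg (fun k _ => by positivity), ← ENNReal.ofReal_mul (by positivity),
      ← hH, inv_mul_cancel₀ hHpos.ne', ENNReal.ofReal_one]
  have hint : ∀ {E : Type} [NormedAddCommGroup E] [NormedSpace ℝ E] [CompleteSpace E] (f : ℝ → E),
      ∫ y, f y ∂M = H⁻¹ • ∑ k ∈ Finset.Icc 1 (n + 1), (k : ℝ)⁻¹ • f (x k) := by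
    intro E _ _ _ f
    rw [hM, integral_smul_measure, integral_finsetSum_measure]
    · rw [ENNReal.toReal_ofReal (by positivity)]
      congr 1
      refine Finset.sum_congr rfl fun k _ => ?_
      rw [integral_smul_measure, integral_dirac, ENNReal.toReal_ofReal (by positivity)]
    · intro k _
      exact (integrable_dirac (by finiteness)).smul_measure (by finiteness)
  refine ⟨⟨M, hprob⟩, fun f => ?_, fun f => ?_⟩
  · simpa using hint f
  · simpa using hint f

lemma charFun_diff (ν : Measure ℝ) [IsProbabilityMeasure ν] (s t : ℝ) :
    ‖charFun ν t - charFun ν s‖ ^ 2 ≤ 2 * ‖1 - charFun ν (t - s)‖ := by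
  have hi : ∀ t : ℝ, Integrable (fun x : ℝ => Complex.exp (t * x * Complex.I)) ν := fun t => by
    refine Integrable.of_bound (C := 1) (by fun_prop) (ae_of_all _ fun x => ?_)
    rw [← Complex.ofReal_mul, Complex.norm_exp_ofReal_mul_I]
  have hpt : ∀ x : ℝ, ‖Complex.exp (t * x * Complex.I) - Complex.exp (s * x * Complex.I)‖ ^ 2
      = 2 * (1 - Complex.exp ((t - s : ℝ) * x * Complex.I)).re := by
    intro x
    rw [← Complex.ofReal_mul, ← Complex.ofReal_mul, ← Complex.ofReal_mul, Complex.sq_norm,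
      Complex.normSq_apply]
    simp only [Complex.sub_re, Complex.sub_im, Complex.exp_ofReal_mul_I_re,
      Complex.exp_ofReal_mul_I_im, Complex.one_re]
    rw [sub_mul t s x, Real.cos_sub]
    nlinarith [Real.sin_sq_add_cos_sq (t * x), Real.sin_sq_add_cos_sq (s * x)]
  have hint2 : Integrable (fun x : ℝ => 1 - Complex.exp ((t - s : ℝ) * x * Complex.I)) ν :=
    (integrable_const _).sub (hi _)
  rw [charFun_apply_real, charFun_apply_real, charFun_apply_real, ← integral_sub (hi t) (hi s)]
  have h1 : ‖∫ x : ℝ, (Complex.exp (t * x * Complex.I) - Complex.exp (s * x * Complex.I)) ∂ν‖ ^ 2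
      ≤ ∫ x : ℝ, ‖Complex.exp (t * x * Complex.I) - Complex.exp (s * x * Complex.I)‖ ^ 2 ∂ν := by
    have hn : Integrable (fun x : ℝ =>
      ‖Complex.exp (t * x * Complex.I) - Complex.exp (s * x * Complex.I)‖) ν := ((hi t).sub (hi s)).norm
    have hn2 : Integrable (fun x : ℝ =>
      ‖Complex.exp (t * x * Complex.I) - Complex.exp (s * x * Complex.I)‖ ^ 2) ν := by
      simp_rw [hpt]
      exact hint2.re.const_mul 2
    refine (pow_le_pow_left₀ (norm_nonneg _) (norm_integral_le_integral_norm _) 2).trans ?_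
    exact ConvexOn.map_integral_le (s := Set.univ) (g := fun y : ℝ => y ^ 2) even_two.convexOn_pow
      (by fun_prop) isClosed_univ (ae_of_all _ fun _ => Set.mem_univ _) hn hn2
  refine h1.trans ?_
  simp_rw [hpt]
  rw [integral_const_mul]
  gcongr
  have h2 : ∫ x : ℝ, (1 - Complex.exp ((t - s : ℝ) * x * Complex.I)).re ∂ν
    = (∫ x : ℝ, (1 - Complex.exp ((t - s : ℝ) * x * Complex.I)) ∂ν).re := integral_re hint2
  rw [h2, integral_sub (integrable_const _) (hi _)]
  simp only [integral_const, probReal_univ, one_smul]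
  exact Complex.re_le_norm _

lemma tendsto_of_ae_charFun (ν : ℕ → ProbabilityMeasure ℝ) (ν₀ : ProbabilityMeasure ℝ)
    (h : ∀ᵐ t : ℝ, Tendsto (fun n => charFun (ν n : Measure ℝ) t) atTop
      (𝓝 (charFun (ν₀ : Measure ℝ) t))) : Tendsto ν atTop (𝓝 ν₀) := by
  refine ProbabilityMeasure.tendsto_of_tendsto_charFun fun t => ?_
  have hc : Continuous (charFun (ν₀ : Measure ℝ)) := by fun_prop
  rw [Metric.tendsto_atTop]
  intro ε hε
  have h' : ∀ᵐ s : ℝ, Tendsto (fun n => charFun (ν n : Measure ℝ) (t - s)) atTop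
      (𝓝 (charFun (ν₀ : Measure ℝ) (t - s))) :=
    (Measure.measurePreserving_sub_left volume t).quasiMeasurePreserving.ae h
  have hd : Dense {s : ℝ | Tendsto (fun n => charFun (ν n : Measure ℝ) s) atTop
      (𝓝 (charFun (ν₀ : Measure ℝ) s)) ∧ Tendsto (fun n => charFun (ν n : Measure ℝ) (t - s)) atTop
      (𝓝 (charFun (ν₀ : Measure ℝ) (t - s)))} := Measure.dense_of_ae (h.and h')
  have hev : ∀ᶠ s in 𝓝 t, ‖charFun (ν₀ : Measure ℝ) t - charFun (ν₀ : Measure ℝ) s‖ < ε / 3 ∧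
      2 * ‖1 - charFun (ν₀ : Measure ℝ) (t - s)‖ < (ε / 3) ^ 2 := by
    refine Filter.Eventually.and ?_ ?_
    · have : Tendsto (fun s => ‖charFun (ν₀ : Measure ℝ) t - charFun (ν₀ : Measure ℝ) s‖) (𝓝 t)
          (𝓝 (‖charFun (ν₀ : Measure ℝ) t - charFun (ν₀ : Measure ℝ) t‖)) :=
        Continuous.tendsto (by fun_prop) t
      rw [sub_self, norm_zero] at this
      exact this.eventually (gt_mem_nhds (by positivity))
    · have : Tendsto (fun s => 2 * ‖1 - charFun (ν₀ : Measure ℝ) (t - s)‖) (𝓝 t)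
          (𝓝 (2 * ‖1 - charFun (ν₀ : Measure ℝ) (t - t)‖)) :=
        Continuous.tendsto (by fun_prop) t
      simp only [sub_self, charFun_zero, probReal_univ, Complex.ofReal_one, norm_zero, mul_zero] at this
      exact this.eventually (gt_mem_nhds (by positivity))
  obtain ⟨s, ⟨hs1, hs2⟩, hs3, hs4⟩ := (hd.inter_nhds_nonempty hev)
  have e1 : ∀ᶠ n in atTop, ‖charFun (ν n : Measure ℝ) s - charFun (ν₀ : Measure ℝ) s‖ < ε / 3 := by
    have := Metric.tendsto_nhds.1 hs1 (ε / 3) (by positivity)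
    simpa [dist_eq_norm] using this
  have e2 : ∀ᶠ n in atTop, 2 * ‖1 - charFun (ν n : Measure ℝ) (t - s)‖ < (ε / 3) ^ 2 :=
    ((hs2.const_sub 1).norm.const_mul 2).eventually (gt_mem_nhds hs4)
  obtain ⟨N, hN⟩ := eventually_atTop.1 (e1.and e2)
  refine ⟨N, fun n hn => ?_⟩
  obtain ⟨f1, f2⟩ := hN n hn
  have f3 : ‖charFun (ν n : Measure ℝ) t - charFun (ν n : Measure ℝ) s‖ < ε / 3 :=
    lt_of_pow_lt_pow_left₀ 2 (by positivity) ((charFun_diff _ s t).trans_lt f2)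
  rw [dist_eq_norm]
  have : charFun (ν n : Measure ℝ) t - charFun (ν₀ : Measure ℝ) t =
    (charFun (ν n : Measure ℝ) t - charFun (ν n : Measure ℝ) s)
    + (charFun (ν n : Measure ℝ) s - charFun (ν₀ : Measure ℝ) s)
    - (charFun (ν₀ : Measure ℝ) t - charFun (ν₀ : Measure ℝ) s) := by ring
  rw [this]
  have g1 := norm_sub_le ((charFun (ν n : Measure ℝ) t - charFun (ν n : Measure ℝ) s)
    + (charFun (ν n : Measure ℝ) s - charFun (ν₀ : Measure ℝ) s))
     (charFun (ν₀ : Measure ℝ) t - charFun (ν₀ : Measure ℝ) s)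
  have g2 := norm_add_le (charFun (ν n : Measure ℝ) t - charFun (ν n : Measure ℝ) s)
    (charFun (ν n : Measure ℝ) s - charFun (ν₀ : Measure ℝ) s)
  linarith

lemma ae_summable_of_bdd {Ω : Type*} {mΩ : MeasurableSpace Ω} (μ : Measure Ω)
    (F : ℕ → Ω → ℝ) (hF : ∀ n ω, 0 ≤ F n ω) (hm : ∀ n, Integrable (F n) μ)
    (C : ℝ) (hb : ∀ N, ∑ n ∈ Finset.range N, ∫ ω, F n ω ∂μ ≤ C) :
    ∀ᵐ ω ∂μ, Summable fun n => F n ω := by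
  have hs : Summable fun n => ∫ ω, F n ω ∂μ :=
    summable_of_sum_range_le (fun n => integral_nonneg (hF n)) hb
  have h1 : ∫⁻ ω, ∑' n, ENNReal.ofReal (F n ω) ∂μ ≠ ⊤ := by
    rw [lintegral_tsum (fun n => (hm n).aemeasurable.ennreal_ofReal)]
    simp_rw [← fun n => ofReal_integral_eq_lintegral_ofReal (hm n) (ae_of_all _ (hF n))]
    rw [← ENNReal.ofReal_tsum_of_nonneg (fun n => integral_nonneg (hF n)) hs]
    exact ENNReal.ofReal_ne_top
  have h2 := ae_lt_top' (AEMeasurable.tsum fun n => (hm n).aemeasurable.ennreal_ofReal) h1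
  filter_upwards [h2] with ω hω
  have := ENNReal.summable_toReal hω.ne
  simpa [ENNReal.toReal_ofReal (hF _ ω)] using this

theorem stmt0
    {Ω : Type*} {mΩ : MeasurableSpace Ω} (μ : Measure Ω) [IsProbabilityMeasure μ]
    (G : ℕ → Ω → ℝ) (Ginf : Ω → ℝ)
    (hGmeas : ∀ n, Measurable (G n)) (hGinfmeas : Measurable Ginf)
    -- convergence in distribution of `G_n` towards `G_∞`
    (hconv : ∀ φ : BoundedContinuousFunction ℝ ℝ,
      Tendsto (fun n : ℕ => ∫ ω, φ (G n ω) ∂μ) atTop (𝓝 (∫ ω, φ (Ginf ω) ∂μ)))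
    -- the quantity `Δ_n(t)`
    (Δ : ℕ → ℝ → Ω → ℂ)
    (hΔ : ∀ n t ω, Δ n t ω = (Real.log n)⁻¹ •
      ∑ k ∈ Finset.Icc 1 n, (k : ℂ)⁻¹ *
        (Complex.exp (t * G k ω * Complex.I)
          - ∫ ω', Complex.exp (t * Ginf ω' * Complex.I) ∂μ))
    -- `sup_{|t|≤r} Σ_{n≥2} E[|Δ_n(t)|²]/(n log n) < ∞` for every `r > 0`
    (hcrit : ∀ r : ℝ, 0 < r → ∃ C : ℝ, ∀ t : ℝ, |t| ≤ r → ∀ N : ℕ,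
      ∑ n ∈ Finset.Icc 2 N, (∫ ω, ‖Δ n t ω‖ ^ 2 ∂μ) / ((n : ℝ) * Real.log n) ≤ C) :
    -- ASCLT
    ∀ᵐ ω ∂μ, ∀ φ : BoundedContinuousFunction ℝ ℝ,
      Tendsto (fun n : ℕ => (Real.log n)⁻¹ * ∑ k ∈ Finset.Icc 1 n, (k : ℝ)⁻¹ * φ (G k ω))
        atTop (𝓝 (∫ ω, φ (Ginf ω) ∂μ)) := by
  have hP : IsProbabilityMeasure (μ.map Ginf) := Measure.isProbabilityMeasure_map hGinfmeas.aemeasurable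
  set ν₀ : ProbabilityMeasure ℝ := ⟨μ.map Ginf, hP⟩ with hν₀
  have hf : ∀ t : ℝ, ∫ ω', Complex.exp (t * Ginf ω' * Complex.I) ∂μ = charFun (ν₀ : Measure ℝ) t := by
    intro t
    rw [charFun_apply_real, hν₀, ProbabilityMeasure.coe_mk,
      integral_map hGinfmeas.aemeasurable (by fun_prop)]
  simp_rw [hf] at hΔ
  have hnorm : ∀ k (t : ℝ) ω, ‖Complex.exp (t * G k ω * Complex.I) - charFun (ν₀ : Measure ℝ) t‖ ≤ 2 := by
    intro k t ω
    refine (norm_sub_le _ _).trans ?_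
    rw [← Complex.ofReal_mul, Complex.norm_exp_ofReal_mul_I]
    have := norm_charFun_le_one (μ := (ν₀ : Measure ℝ)) t
    linarith
  have hmeasJ : ∀ n, Measurable fun p : ℝ × Ω => Δ n p.1 p.2 := by
    intro n
    simp_rw [hΔ]
    fun_prop
  have hmeas : ∀ n t, Measurable (Δ n t) := fun n t => (hmeasJ n).comp measurable_prodMk_left
  have hbound : ∀ n t, ∃ B, ∀ ω, ‖Δ n t ω‖ ≤ B := by
    intro n t
    refine ⟨‖(Real.log n)⁻¹‖ * ∑ k ∈ Finset.Icc 1 n, ‖(k : ℂ)⁻¹‖ * 2, fun ω => ?_⟩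
    rw [hΔ, norm_smul]
    gcongr
    refine norm_sum_le_of_le _ fun k _ => ?_
    rw [norm_mul]
    gcongr
    exact hnorm k t ω
  have hfix : ∀ t : ℝ, ∀ᵐ ω ∂μ, Tendsto (fun n => Δ n t ω) atTop (𝓝 0) := by
    intro t
    obtain ⟨C, hC⟩ := hcrit (|t| + 1) (by positivity)
    have hC := hC t (by linarith)
    have hsum : ∀ᵐ ω ∂μ, Summable fun n => ‖Δ n t ω‖ ^ 2 * wgt n := by
      refine ae_summable_of_bdd μ (fun n ω => ‖Δ n t ω‖ ^ 2 * wgt n)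
        (fun n ω => mul_nonneg (by positivity) (wgt_nonneg n)) (fun n => ?_) C (fun N => ?_)
      · obtain ⟨B, hB⟩ := hbound n t
        refine Integrable.mul_const (Integrable.of_bound (C := B ^ 2) ?_ (ae_of_all _ fun ω => ?_)) _
        · exact ((hmeas n t).norm.pow_const 2).aestronglyMeasurable
        · rw [norm_pow, norm_norm]
          exact pow_le_pow_left₀ (norm_nonneg _) (hB ω) 2
      · refine le_trans (le_of_eq ?_) (hC (N - 1))
        simp_rw [integral_mul_const, div_eq_mul_inv]
        symm
        refine Finset.sum_subset (fun k hk => ?_) (fun k hk hk' => ?_)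
        · simp at hk ⊢; omega
        · have : k = 0 ∨ k = 1 := by simp at hk hk'; omega
          rcases this with rfl | rfl <;> simp [wgt]
    filter_upwards [hsum] with ω hω
    exact log_avg_tendsto _ (fun k => hnorm k t ω) _ (fun n => hΔ n t ω) hω
  have hae : ∀ᵐ ω ∂μ, ∀ᵐ t : ℝ, Tendsto (fun n => Δ n t ω) atTop (𝓝 0) := by
    refine (Measure.ae_ae_comm (μ := (volume : Measure ℝ)) (ν := μ)
      (p := fun t ω => Tendsto (fun n => Δ n t ω) atTop (𝓝 0)) ?_).1 (ae_of_all _ hfix)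
    exact measurableSet_tendsto (𝓝 0) hmeasJ
  filter_upwards [hae] with ω hω
  choose ν hν1 hν2 using exists_prob (fun k => G k ω)
  have hH := (tendsto_add_atTop_iff_nat 1).2 tendsto_sum_inv_div_log
  have hconvν : Tendsto ν atTop (𝓝 ν₀) := by
    refine tendsto_of_ae_charFun ν ν₀ ?_
    filter_upwards [hω] with t ht
    have ht1 := (tendsto_add_atTop_iff_nat 1).2 ht
    have h3 := (hH.inv₀ one_ne_zero).smul ht1
    rw [smul_zero] at h3
    rw [← tendsto_sub_nhds_zero_iff]
    refine h3.congr' ?_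
    filter_upwards [eventually_ge_atTop 1] with n hn
    have hn2 : (1 : ℝ) ≤ n := by exact_mod_cast hn
    have hl : 0 < Real.log ((n + 1 : ℕ) : ℝ) := Real.log_pos (by push_cast; linarith)
    have hHp : 0 < ∑ k ∈ Finset.Icc 1 (n + 1), (k : ℝ)⁻¹ :=
      (Real.log_pos (by push_cast; linarith)).trans_le (le_sum_inv (n + 1))
    rw [charFun_apply_real, hν2, hΔ, smul_smul]
    set H := ∑ k ∈ Finset.Icc 1 (n + 1), (k : ℝ)⁻¹ with hHdef
    have hHC : ∑ k ∈ Finset.Icc 1 (n + 1), (k : ℂ)⁻¹ = (H : ℂ) := by rw [hHdef]; push_cast; rfl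
    have e1 : ((Real.log ((n + 1 : ℕ) : ℝ))⁻¹ * H)⁻¹ * (Real.log ((n + 1 : ℕ) : ℝ))⁻¹ = H⁻¹ := by
      field_simp
    rw [e1]
    simp_rw [mul_sub]
    rw [Finset.sum_sub_distrib, ← Finset.sum_mul, hHC, smul_sub]
    congr 1
    rw [← smul_eq_mul, Complex.coe_smul, smul_smul, inv_mul_cancel₀ hHp.ne', one_smul]
  intro φ
  have h4 := ProbabilityMeasure.tendsto_iff_forall_integral_tendsto.1 hconvν φ
  have h5 : ∫ x, φ x ∂(ν₀ : Measure ℝ) = ∫ ω, φ (Ginf ω) ∂μ := by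
    rw [hν₀, ProbabilityMeasure.coe_mk,
      integral_map hGinfmeas.aemeasurable φ.continuous.measurable.aestronglyMeasurable]
  rw [h5] at h4
  rw [← tendsto_add_atTop_iff_nat 1]
  have h6 := hH.mul h4
  rw [one_mul] at h6
  refine h6.congr fun n => ?_
  have hHp : 0 < ∑ k ∈ Finset.Icc 1 (n + 1), (k : ℝ)⁻¹ :=
    (Real.log_pos (by push_cast; linarith [(Nat.cast_nonneg n : (0 : ℝ) ≤ n)])).trans_le
      (le_sum_inv (n + 1))
  rw [hν1, mul_assoc, mul_inv_cancel_left₀ hHp.ne']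
end

section
/- Let (G_n)_{n≥1} be a centered Gaussian sequence with unit variances: every finite real-linear combination of the G_n has a centered Gaussian distribution, E[G_n] = 0 and E[G_n²] = 1 for all n. If Σ_{n≥2} (1/(n log³ n)) Σ_{k,l=1}^n |E[G_k G_l]|/(kl) < ∞, then (G_n) satisfies the ASCLT: almost surely, for every bounded continuous φ : ℝ → ℝ, (1/log n) Σ_{k=1}^n (1/k) φ(G_k) → E[φ(N)] as n → ∞, where N is a standard Gaussian random variable. -/
open MeasureTheory ProbabilityTheory Filter Topology

/-- `Σ 1/(n log n)` diverges. -/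
lemma aux_not_summable : ¬ Summable (fun n : ℕ => 1 / ((n : ℝ) * Real.log n)) := by
  intro h
  have h2 : ∀ n : ℕ, 2 ≤ n → Real.log (Real.log (n+1 : ℕ)) - Real.log (Real.log n)
      ≤ 1 / ((n : ℝ) * Real.log n) := by
    intro n hn
    have hn' : (2:ℝ) ≤ n := by exact_mod_cast hn
    have hl : 0 < Real.log n := Real.log_pos (by linarith)
    have hl' : 0 < Real.log (n+1 : ℕ) := Real.log_pos (by push_cast; linarith)
    have h1 : Real.log (n+1 : ℕ) - Real.log n ≤ 1 / n := by
      rw [← Real.log_div (by positivity) (by positivity)]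
      refine (Real.log_le_sub_one_of_pos (by positivity)).trans ?_
      push_cast
      field_simp
      linarith
    rw [← Real.log_div (by positivity) (by positivity)]
    refine (Real.log_le_sub_one_of_pos (by positivity)).trans ?_
    rw [div_sub_one hl.ne', div_le_iff₀ hl]
    refine h1.trans (le_of_eq ?_)
    field_simp
  have h3 : ∀ n : ℕ, 2 ≤ n → Real.log (Real.log n) ≤ Real.log (Real.log 2)
      + ∑ k ∈ Finset.range n, 1 / ((k : ℝ) * Real.log k) := by
    intro n hn
    induction n, hn using Nat.le_induction with
    | base =>
      have : 0 ≤ ∑ k ∈ Finset.range 2, 1 / ((k : ℝ) * Real.log k) := by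
        apply Finset.sum_nonneg; intro i _; positivity
      push_cast
      linarith
    | succ n hn ih =>
      rw [Finset.sum_range_succ]
      have := h2 n hn
      linarith
  have h4 : Tendsto (fun n : ℕ => Real.log (Real.log n)) atTop atTop :=
    Real.tendsto_log_atTop.comp (Real.tendsto_log_atTop.comp tendsto_natCast_atTop_atTop)
  obtain ⟨n, hn1, hn2⟩ := ((h4.eventually_gt_atTop (Real.log (Real.log 2) +
    ∑' k : ℕ, 1 / ((k : ℝ) * Real.log k))).and (eventually_ge_atTop 2)).exists
  have := h3 n hn2
  have h5 := h.sum_le_tsum (Finset.range n) (fun i _ => by positivity)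
  linarith

/-- Deterministic slow variation lemma. -/
lemma aux_det (a : ℕ → ℝ) (C : ℝ) (h0 : ∀ n, 0 ≤ a n)
    (hinc : ∀ n : ℕ, 1 ≤ n → |a (n+1) - a n| ≤ C / n)
    (hbd : ∀ n : ℕ, 2 ≤ n → a n ≤ C * Real.log n)
    (hs : Summable (fun n : ℕ => 1 / ((n : ℝ) * Real.log n ^ 3) * a n ^ 2)) :
    Tendsto (fun n : ℕ => a n / Real.log n) atTop (𝓝 0) := by
  set x : ℕ → ℝ := fun n => a n / Real.log n with hx
  have hx0 : ∀ n, 0 ≤ x n := fun n => by have := h0 n; simp only [hx]; positivity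
  have hs' : Summable (fun n : ℕ => x n ^ 2 / (n * Real.log n)) := by
    refine hs.congr fun n => ?_
    simp only [hx, div_pow]
    by_cases hl : Real.log n = 0
    · simp [hl]
    by_cases hn : (n:ℝ) = 0
    · simp [hn]
    field_simp
  have hinc' : ∀ n : ℕ, 2 ≤ n → |x (n+1) - x n| ≤ 2 * C / (n * Real.log n) := by
    intro n hn
    have hn' : (2:ℝ) ≤ n := by exact_mod_cast hn
    have hl : 0 < Real.log n := Real.log_pos (by linarith)
    have hmono : Real.log n ≤ Real.log (n+1 : ℕ) :=
      Real.log_le_log (by linarith) (by push_cast; linarith)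
    have hl' : 0 < Real.log (n+1 : ℕ) := hl.trans_le hmono
    have h1 : Real.log (n+1 : ℕ) - Real.log n ≤ 1 / n := by
      rw [← Real.log_div (by positivity) (by positivity)]
      refine (Real.log_le_sub_one_of_pos (by positivity)).trans ?_
      push_cast
      field_simp
      linarith
    have hC : 0 ≤ C := by
      have := (h0 n).trans (hbd n hn)
      exact nonneg_of_mul_nonneg_left this hl
    have e : x (n+1) - x n = (a (n+1) - a n) / Real.log (n+1 : ℕ)
        - x n * ((Real.log (n+1 : ℕ) - Real.log n) / Real.log (n+1 : ℕ)) := by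
      simp only [hx]; field_simp; ring
    have hxC : x n ≤ C := by
      simp only [hx]; rw [div_le_iff₀ hl]; exact hbd n hn
    have b1 : |(a (n+1) - a n) / Real.log (n+1 : ℕ)| ≤ C / n / Real.log n := by
      rw [abs_div, abs_of_pos hl']
      have := hinc n (by omega)
      gcongr
    have b2 : |x n * ((Real.log (n+1 : ℕ) - Real.log n) / Real.log (n+1 : ℕ))|
        ≤ C * ((1 / n) / Real.log n) := by
      rw [abs_of_nonneg (mul_nonneg (hx0 n) (div_nonneg (by linarith) hl'.le))]
      gcongr
    rw [e]
    refine (abs_sub _ _).trans ((add_le_add b1 b2).trans (le_of_eq ?_))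
    field_simp; ring
  have hcmp : ∀ n : ℕ, 2 ≤ n → ((n+1 : ℕ) : ℝ) * Real.log (n+1 : ℕ) ≤ 4 * (n * Real.log n) := by
    intro n hn
    have hn' : (2:ℝ) ≤ n := by exact_mod_cast hn
    have hl : 0 < Real.log n := Real.log_pos (by linarith)
    have hmono : Real.log (n+1 : ℕ) ≤ 2 * Real.log n := by
      rw [show 2 * Real.log n = Real.log ((n:ℝ)^2) by rw [Real.log_pow]; norm_num]
      apply Real.log_le_log (by positivity)
      push_cast; nlinarith
    have : ((n+1 : ℕ) : ℝ) ≤ 2 * n := by push_cast; linarith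
    calc _ ≤ (2 * (n:ℝ)) * (2 * Real.log n) := by gcongr
      _ = _ := by ring
  have hC : 0 ≤ C := by
    have := (h0 2).trans (hbd 2 le_rfl)
    exact nonneg_of_mul_nonneg_left this (Real.log_pos (by norm_num))
  have hdiff : Summable (fun n : ℕ => x (n+2+1) ^ 3 - x (n+2) ^ 3) := by
    have s1 := (summable_nat_add_iff 3).2 hs'
    have s2 := (summable_nat_add_iff 2).2 hs'
    refine Summable.of_norm_bounded ((s1.mul_left (12 * C)).add (s2.mul_left (3 * C))) ?_
    intro m
    obtain ⟨n, hn, hnm⟩ : ∃ n, 2 ≤ n ∧ n = m + 2 := ⟨m+2, by omega, rfl⟩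
    rw [← hnm, show m + 3 = n + 1 by omega, Real.norm_eq_abs]
    have hn' : (2:ℝ) ≤ n := by exact_mod_cast hn
    have hl : 0 < Real.log n := Real.log_pos (by linarith)
    have hl' : 0 < Real.log (n+1 : ℕ) := Real.log_pos (by push_cast; linarith)
    have e : x (n+1) ^ 3 - x n ^ 3 = (x (n+1) - x n) * (x (n+1)^2 + x (n+1) * x n + x n ^2) := by
      ring
    have q : |x (n+1)^2 + x (n+1) * x n + x n ^2| ≤ 3/2 * (x (n+1)^2 + x n ^2) := by
      have := hx0 n
      have := hx0 (n+1)
      rw [abs_of_nonneg (by positivity)]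
      nlinarith [sq_nonneg (x (n+1) - x n)]
    rw [e, abs_mul]
    calc _ ≤ (2 * C / (n * Real.log n)) * (3/2 * (x (n+1)^2 + x n ^2)) := by
            gcongr
            exact hinc' n hn
      _ = 3 * C * (x (n+1)^2 / (n * Real.log n)) + 3 * C * (x n ^2 / (n * Real.log n)) := by
            field_simp;
      _ ≤ _ := by
        gcongr ?_ + _
        rw [show 12 * C * (x (n+1) ^ 2 / (((n+1 : ℕ):ℝ) * Real.log (n+1 : ℕ))) =
          3 * C * (x (n+1) ^ 2 / ((((n+1 : ℕ):ℝ) * Real.log (n+1 : ℕ)) / 4)) by field_simp; ring]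
        gcongr
        have := hcmp n hn
        linarith
  -- convergence of the cubes
  obtain ⟨L, hL⟩ : ∃ L, Tendsto (fun n => x (n+2) ^ 3) atTop (𝓝 L) := by
    have := hdiff.hasSum.tendsto_sum_nat
    have e : ∀ N, ∑ i ∈ Finset.range N, (x (i+2+1) ^ 3 - x (i+2) ^ 3) = x (N+2)^3 - x 2 ^ 3 := by
      intro N
      have := Finset.sum_range_sub (fun i => x (i+2) ^ 3) N
      simp only [zero_add] at this
      rw [← this]
    simp only [e] at this
    refine ⟨_, (this.add_const (x 2 ^ 3)).congr fun n => by ring⟩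
  have hL' : Tendsto (fun n => x n ^ 3) atTop (𝓝 L) := (tendsto_add_atTop_iff_nat 2).1 hL
  have hL0 : 0 ≤ L := ge_of_tendsto' hL' fun n => pow_nonneg (hx0 n) 3
  have hLz : L = 0 := by
    by_contra hne
    have hLp : 0 < L := lt_of_le_of_ne hL0 (Ne.symm hne)
    obtain ⟨N, hN⟩ := eventually_atTop.1 (hL'.eventually (lt_mem_nhds (half_lt_self hLp)))
    have hCp : ∀ n, 2 ≤ n → x n ≤ C := by
      intro n hn
      have hn' : (2:ℝ) ≤ n := by exact_mod_cast hn
      have hl : 0 < Real.log n := Real.log_pos (by linarith)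
      simp only [hx]; rw [div_le_iff₀ hl]; exact hbd n hn
    apply aux_not_summable
    rw [← summable_nat_add_iff (N+2)]
    refine Summable.of_nonneg_of_le (fun n => by positivity) ?_
      (((summable_nat_add_iff (N+2)).2 hs').mul_left (2 * C / L))
    intro n
    have h1 := hN (n + (N+2)) (by omega)
    have h2 := hCp (n + (N+2)) (by omega)
    have h3 : 1 ≤ 2 * C / L * x (n + (N+2)) ^ 2 := by
      rw [div_mul_eq_mul_div, le_div_iff₀ hLp]
      have : x (n + (N+2)) ^ 3 ≤ C * x (n + (N+2)) ^ 2 := by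
        rw [pow_succ']; gcongr
      linarith
    rw [← mul_div_assoc]
    gcongr
  rw [hLz] at hL'
  have := hL'.rpow_const (p := (1/3 : ℝ)) (Or.inr (by norm_num))
  rw [Real.zero_rpow (by norm_num)] at this
  refine this.congr fun n => ?_
  rw [← Real.rpow_natCast, ← Real.rpow_mul (hx0 n)]
  norm_num

lemma aux_gauss {Ω : Type*} {mΩ : MeasurableSpace Ω} (μ : Measure Ω) [IsProbabilityMeasure μ]
    (X : Ω → ℝ) (hX : Measurable X) (v : NNReal) (h : Measure.map X μ = gaussianReal 0 v) :
    MemLp X 2 μ ∧ ∫ ω, X ω ^ 2 ∂μ = v ∧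
      ∀ t : ℝ, ∫ ω, Complex.exp (t * X ω * Complex.I) ∂μ = Complex.exp (-(v * t ^ 2 / 2)) := by
  refine ⟨?_, ?_, ?_⟩
  · have := memLp_id_gaussianReal' (μ := 0) (v := v) 2 (by simp)
    rw [← h, memLp_map_measure_iff (by fun_prop) (by fun_prop)] at this
    exact this
  · have h1 := variance_fun_id_gaussianReal (μ := 0) (v := v)
    rw [variance_eq_integral (by fun_prop), integral_id_gaussianReal, ← h,
      integral_map (by fun_prop) (by fun_prop)] at h1
    simpa using h1
  · intro t
    have h1 := charFun_gaussianReal (μ := 0) (v := v) t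
    rw [← h, charFun_apply_real, integral_map (by fun_prop) (by fun_prop)] at h1
    rw [h1]
    simp

lemma aux_exp (c r : ℝ) (hc : 0 ≤ c) (hr : |r| ≤ 1) :
    |Real.exp (-(c * (1 - r))) - Real.exp (-c)| ≤ c * |r| := by
  have hr' := abs_le.1 hr
  have hcr : c * |r| ≤ c := by nlinarith
  have e1 : Real.exp (-(c * (1 - r))) ≤ 1 := Real.exp_le_one_iff.2 (by nlinarith)
  have e2 : Real.exp (-c) ≤ 1 := Real.exp_le_one_iff.2 (by linarith)
  have k1 : Real.exp (-(c * (1 - r))) - Real.exp (-c) ≤ c * |r| := by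
    have := Real.add_one_le_exp (-(c*r))
    have h2 : Real.exp (-c) = Real.exp (-(c * (1-r))) * Real.exp (-(c*r)) := by
      rw [← Real.exp_add]; ring_nf
    have h3 : c * r ≤ c * |r| := by gcongr; exact le_abs_self r
    have h4 : 0 ≤ c * |r| := by positivity
    have := Real.exp_pos (-(c * (1 - r)))
    rw [h2]
    nlinarith
  have k2 : Real.exp (-c) - Real.exp (-(c * (1 - r))) ≤ c * |r| := by
    have := Real.add_one_le_exp (c*r)
    have h2 : Real.exp (-(c * (1-r))) = Real.exp (-c) * Real.exp (c*r) := by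
      rw [← Real.exp_add]; ring_nf
    have h3 : -(c * r) ≤ c * |r| := by
      rw [← mul_neg]; gcongr; exact neg_le_abs r
    have h4 : 0 ≤ c * |r| := by positivity
    have := Real.exp_pos (-c)
    rw [h2]
    nlinarith
  exact abs_le.2 ⟨by linarith, k1⟩

lemma aux_int {Ω : Type*} {mΩ : MeasurableSpace Ω} (μ : Measure Ω) [IsProbabilityMeasure μ]
    (X : Ω → ℝ) (hX : Measurable X) (t : ℝ) :
    Integrable (fun ω => Complex.exp (t * X ω * Complex.I)) μ := by
  refine Integrable.of_bound (by fun_prop) 1 (ae_of_all _ fun ω => ?_)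
  rw [← Complex.ofReal_mul, Complex.norm_exp_ofReal_mul_I]

/-- The covariance estimate. -/
lemma aux_cov {Ω : Type*} {mΩ : MeasurableSpace Ω} (μ : Measure Ω) [IsProbabilityMeasure μ]
    (X Y : Ω → ℝ) (hX : Measurable X) (hY : Measurable Y)
    (vX vY v : NNReal)
    (gX : Measure.map X μ = gaussianReal 0 vX) (gY : Measure.map Y μ = gaussianReal 0 vY)
    (g : Measure.map (fun ω => X ω - Y ω) μ = gaussianReal 0 v)
    (hvX : ∫ ω, X ω ^ 2 ∂μ = 1) (hvY : ∫ ω, Y ω ^ 2 ∂μ = 1) (t : ℝ) :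
    ‖∫ ω, (Complex.exp (t * X ω * Complex.I) - Complex.exp (-(t^2/2))) *
      (starRingEnd ℂ) (Complex.exp (t * Y ω * Complex.I) - Complex.exp (-(t^2/2))) ∂μ‖
      ≤ t ^ 2 * |∫ ω, X ω * Y ω ∂μ| := by
  obtain ⟨mX, qX, cX⟩ := aux_gauss μ X hX vX gX
  obtain ⟨mY, qY, cY⟩ := aux_gauss μ Y hY vY gY
  obtain ⟨-, q, c⟩ := aux_gauss μ (fun ω => X ω - Y ω) (hX.sub hY) v g
  have iX := mX.integrable_sq
  have iY := mY.integrable_sq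
  have iXY : Integrable (fun ω => X ω * Y ω) μ := mX.integrable_mul mY
  set r := ∫ ω, X ω * Y ω ∂μ with hr
  have hsub : ∫ ω, (X ω - Y ω) ^ 2 ∂μ = 2 - 2 * r := by
    have : ∀ ω, (X ω - Y ω) ^ 2 = (X ω ^ 2 + Y ω ^ 2) - 2 * (X ω * Y ω) := fun ω => by ring
    simp_rw [this]
    have iS : Integrable (fun ω => X ω ^ 2 + Y ω ^ 2) μ := iX.add iY
    rw [integral_sub iS (iXY.const_mul 2), integral_add iX iY, integral_const_mul,
      hvX, hvY, ← hr]
    norm_num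
  have hadd : ∫ ω, (X ω + Y ω) ^ 2 ∂μ = 2 + 2 * r := by
    have : ∀ ω, (X ω + Y ω) ^ 2 = (X ω ^ 2 + Y ω ^ 2) + 2 * (X ω * Y ω) := fun ω => by ring
    simp_rw [this]
    have iS : Integrable (fun ω => X ω ^ 2 + Y ω ^ 2) μ := iX.add iY
    rw [integral_add iS (iXY.const_mul 2), integral_add iX iY, integral_const_mul,
      hvX, hvY, ← hr]
    norm_num
  have hr1 : |r| ≤ 1 := by
    have p1 : 0 ≤ ∫ ω, (X ω - Y ω) ^ 2 ∂μ := integral_nonneg fun ω => sq_nonneg _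
    have p2 : 0 ≤ ∫ ω, (X ω + Y ω) ^ 2 ∂μ := integral_nonneg fun ω => sq_nonneg _
    rw [abs_le]; constructor <;> linarith
  have hv : (v : ℝ) = 2 - 2 * r := by rw [← q, hsub]
  have hvX1 : (vX : ℝ) = 1 := by rw [← qX, hvX]
  have hvY1 : (vY : ℝ) = 1 := by rw [← qY, hvY]
  have hvX1' : (vX : ℂ) = 1 := by exact_mod_cast congrArg (fun x : ℝ => (x : ℂ)) hvX1
  have hvY1' : (vY : ℂ) = 1 := by exact_mod_cast congrArg (fun x : ℝ => (x : ℂ)) hvY1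
  have hv' : (v : ℂ) = 2 - 2 * r := by exact_mod_cast congrArg (fun x : ℝ => (x : ℂ)) hv
  have conjE : ∀ y : ℝ, (starRingEnd ℂ) (Complex.exp (t * y * Complex.I)) =
      Complex.exp ((-t : ℝ) * y * Complex.I) := by
    intro y
    rw [← Complex.exp_conj]
    simp
  have conjc : (starRingEnd ℂ) (Complex.exp (-((t:ℂ)^2/2))) = Complex.exp (-(t^2/2)) := by
    rw [← Complex.exp_conj]
    simp [map_ofNat]
  have key : ∫ ω, (Complex.exp (t * X ω * Complex.I) - Complex.exp (-(t^2/2))) *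
      (starRingEnd ℂ) (Complex.exp (t * Y ω * Complex.I) - Complex.exp (-(t^2/2))) ∂μ
      = ((Real.exp (-(t^2 * (1 - r))) - Real.exp (-t^2) : ℝ) : ℂ) := by
    have pt : ∀ ω, (Complex.exp (t * X ω * Complex.I) - Complex.exp (-(t^2/2))) *
      (starRingEnd ℂ) (Complex.exp (t * Y ω * Complex.I) - Complex.exp (-(t^2/2))) =
      (Complex.exp (t * ((X ω - Y ω : ℝ) : ℂ) * Complex.I) -
        Complex.exp (-(t^2/2)) * Complex.exp (t * X ω * Complex.I)) -
        (Complex.exp (-(t^2/2)) * Complex.exp ((-t : ℝ) * Y ω * Complex.I)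
        - Complex.exp (-(t^2/2)) * Complex.exp (-(t^2/2))) := by
      intro ω
      rw [map_sub, conjE, conjc]
      have : Complex.exp (t * ((X ω - Y ω : ℝ) : ℂ) * Complex.I) =
        Complex.exp (t * X ω * Complex.I) * Complex.exp ((-t : ℝ) * Y ω * Complex.I) := by
        rw [← Complex.exp_add]; push_cast; ring_nf
      rw [this]; ring
    simp_rw [pt]
    have i1 := aux_int μ (fun ω => X ω - Y ω) (hX.sub hY) t
    have i2 := (aux_int μ _ hX t).const_mul (Complex.exp (-(t^2/2)))
    have i3 := (aux_int μ _ hY (-t)).const_mul (Complex.exp (-(t^2/2)))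
    rw [integral_sub (by fun_prop) (by fun_prop), integral_sub i1 i2,
      integral_sub i3 (integrable_const _), integral_const_mul, integral_const_mul, c t, cX t,
      cY (-t), hv', hvX1', hvY1']
    simp only [integral_const, probReal_univ, one_smul]
    push_cast
    have a1 : -((1:ℂ) * (-(t:ℂ))^2/2) = -(t^2/2) := by ring
    have a2 : -((1:ℂ) * ((t:ℂ))^2/2) = -(t^2/2) := by ring
    have a3 : -((2 - 2 * (r:ℂ)) * t^2/2) = -(t^2 * (1 - r)) := by ring
    rw [a1, a2, a3, sub_self, sub_zero, ← Complex.exp_add]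
    congr 2
    ring
  rw [key, Complex.norm_real, Real.norm_eq_abs]
  exact aux_exp _ _ (sq_nonneg t) hr1

/-- Weighted centred exponential sums. -/
noncomputable def asA (x : ℕ → ℝ) (t : ℝ) (n : ℕ) : ℂ :=
  ∑ k ∈ Finset.Icc 1 n, (k : ℂ)⁻¹ *
    (Complex.exp (t * x k * Complex.I) - Complex.exp (-(t^2/2)))

lemma aux_Z_bound (y t : ℝ) :
    ‖Complex.exp (t * y * Complex.I) - Complex.exp (-(t^2/2))‖ ≤ 2 := by
  have h1 : ‖Complex.exp (t * y * Complex.I)‖ = 1 := by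
    rw [← Complex.ofReal_mul, Complex.norm_exp_ofReal_mul_I]
  have h2 : ‖Complex.exp (-((t:ℂ)^2/2))‖ ≤ 1 := by
    rw [show -((t:ℂ)^2/2) = ((-(t^2/2) : ℝ) : ℂ) by push_cast; ring, Complex.norm_exp_ofReal]
    exact Real.exp_le_one_iff.2 (by have := sq_nonneg t; linarith)
  refine (norm_sub_le _ _).trans ?_
  linarith

lemma aux_H (n : ℕ) : ((harmonic n : ℚ) : ℝ) = ∑ k ∈ Finset.Icc 1 n, (k : ℝ)⁻¹ := by
  rw [harmonic_eq_sum_Icc]; push_cast; rfl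

lemma asA_bound (x : ℕ → ℝ) (t : ℝ) (n : ℕ) :
    ‖asA x t n‖ ≤ 2 * ∑ k ∈ Finset.Icc 1 n, (k : ℝ)⁻¹ := by
  rw [asA, Finset.mul_sum]
  refine norm_sum_le_of_le _ fun k _ => ?_
  rw [norm_mul, norm_inv, Complex.norm_natCast, mul_comm]
  gcongr
  exact aux_Z_bound _ _

lemma asA_det (x : ℕ → ℝ) (t : ℝ)
    (hs : Summable (fun n : ℕ => 1 / ((n : ℝ) * Real.log n ^ 3) * ‖asA x t n‖ ^ 2)) :
    Tendsto (fun n : ℕ => ‖asA x t n‖ / Real.log n) atTop (𝓝 0) := by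
  refine aux_det _ 6 (fun n => norm_nonneg _) ?_ ?_ hs
  · intro n hn
    have hn' : (1:ℝ) ≤ n := by exact_mod_cast hn
    refine (abs_norm_sub_norm_le _ _).trans ?_
    have : asA x t (n+1) - asA x t n = ((n+1 : ℕ) : ℂ)⁻¹ *
        (Complex.exp (t * x (n+1) * Complex.I) - Complex.exp (-(t^2/2))) := by
      rw [asA, Finset.sum_Icc_succ_top (by omega), ← asA]; ring
    rw [this, norm_mul, norm_inv, Complex.norm_natCast]
    calc _ ≤ ((n:ℝ))⁻¹ * 2 := by
          gcongr
          · simp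
          · exact aux_Z_bound _ _
      _ ≤ 6 / n := by rw [div_eq_inv_mul]; gcongr; norm_num
  · intro n hn
    refine (asA_bound x t n).trans ?_
    rw [← aux_H]
    have h1 := harmonic_le_one_add_log n
    have hn' : (2:ℝ) ≤ n := by exact_mod_cast hn
    have h2 : Real.log 2 ≤ Real.log n := Real.log_le_log (by norm_num) hn'
    have h3 := Real.log_two_gt_d9
    linarith

lemma asA_measurable {Ω : Type*} {mΩ : MeasurableSpace Ω}
    (G : ℕ → Ω → ℝ) (hG : ∀ n, Measurable (G n)) (n : ℕ) :
    Measurable (fun p : Ω × ℝ => asA (fun k => G k p.1) p.2 n) := by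
  unfold asA
  fun_prop

lemma aux_ae_summable {Ω : Type*} {mΩ : MeasurableSpace Ω} (μ : Measure Ω)
    (f : ℕ → Ω → ℝ) (h0 : ∀ n ω, 0 ≤ f n ω) (hf : ∀ n, Integrable (f n) μ)
    (hs : Summable (fun n => ∫ ω, f n ω ∂μ)) : ∀ᵐ ω ∂μ, Summable (fun n => f n ω) := by
  have hm : ∀ n, AEMeasurable (fun ω => ENNReal.ofReal (f n ω)) μ :=
    fun n => (hf n).aemeasurable.ennreal_ofReal
  have h1 : ∫⁻ ω, ∑' n, ENNReal.ofReal (f n ω) ∂μ ≠ ⊤ := by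
    rw [lintegral_tsum hm]
    simp_rw [← ofReal_integral_eq_lintegral_ofReal (hf _) (ae_of_all _ (h0 _))]
    rw [← ENNReal.ofReal_tsum_of_nonneg (fun n => integral_nonneg (h0 n)) hs]
    exact ENNReal.ofReal_ne_top
  filter_upwards [ae_lt_top' (AEMeasurable.tsum hm) h1] with ω hω
  refine (ENNReal.summable_toReal hω.ne).congr fun n => ?_
  rw [ENNReal.toReal_ofReal (h0 n ω)]

lemma asA_sq_integral {Ω : Type*} {mΩ : MeasurableSpace Ω} (μ : Measure Ω) [IsProbabilityMeasure μ]
    (G : ℕ → Ω → ℝ) (hGmeas : ∀ n, Measurable (G n))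
    (hGauss : ∀ (s : Finset ℕ) (a : ℕ → ℝ), ∃ v : NNReal,
      Measure.map (fun ω => ∑ i ∈ s, a i * G i ω) μ = gaussianReal 0 v)
    (hvar : ∀ n, ∫ ω, (G n ω) ^ 2 ∂μ = 1) (t : ℝ) (n : ℕ) :
    ∫ ω, ‖asA (fun k => G k ω) t n‖ ^ 2 ∂μ ≤ t ^ 2 *
      ∑ k ∈ Finset.Icc 1 n, ∑ l ∈ Finset.Icc 1 n,
          |∫ ω, G k ω * G l ω ∂μ| / ((k : ℝ) * (l : ℝ)) := by
  have g1 : ∀ k, ∃ v : NNReal, Measure.map (G k) μ = gaussianReal 0 v := by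
    intro k
    obtain ⟨v, hv⟩ := hGauss {k} (fun _ => 1)
    exact ⟨v, by simpa using hv⟩
  have g2 : ∀ k l, ∃ v : NNReal, Measure.map (fun ω => G k ω - G l ω) μ = gaussianReal 0 v := by
    intro k l
    by_cases hkl : k = l
    · obtain ⟨v, hv⟩ := hGauss ∅ (fun _ => 1)
      exact ⟨v, by simpa [hkl] using hv⟩
    · obtain ⟨v, hv⟩ := hGauss {k, l} (fun i => if i = k then 1 else -1)
      refine ⟨v, ?_⟩
      rw [← hv]
      congr 1
      ext ω
      rw [Finset.sum_pair hkl]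
      simp [Ne.symm hkl, sub_eq_add_neg]
  set Z : ℕ → Ω → ℂ := fun k ω =>
    Complex.exp (t * G k ω * Complex.I) - Complex.exp (-(t^2/2)) with hZ
  have hcov : ∀ k l, ‖∫ ω, Z k ω * (starRingEnd ℂ) (Z l ω) ∂μ‖
      ≤ t ^ 2 * |∫ ω, G k ω * G l ω ∂μ| := by
    intro k l
    obtain ⟨v1, h1⟩ := g1 k
    obtain ⟨v2, h2⟩ := g1 l
    obtain ⟨v, h⟩ := g2 k l
    exact aux_cov μ _ _ (hGmeas k) (hGmeas l) v1 v2 v h1 h2 h (hvar k) (hvar l) t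
  have hZm : ∀ k, Measurable (Z k) := fun k => by simp only [hZ]; fun_prop
  have hInt : ∀ k l, Integrable (fun ω => Z k ω * (starRingEnd ℂ) (Z l ω)) μ := by
    intro k l
    have hm : Measurable (fun ω => (starRingEnd ℂ) (Z l ω)) :=
      Complex.continuous_conj.measurable.comp (hZm l)
    refine Integrable.of_bound ((hZm k).mul hm).aestronglyMeasurable
      (2 * 2) (ae_of_all _ fun ω => ?_)
    rw [norm_mul, RCLike.norm_conj]
    gcongr
    · exact aux_Z_bound _ _
    · exact aux_Z_bound _ _
  have e1 : ∀ ω, ((‖asA (fun k => G k ω) t n‖ ^ 2 : ℝ) : ℂ) =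
      ∑ k ∈ Finset.Icc 1 n, ∑ l ∈ Finset.Icc 1 n,
        ((k:ℂ)⁻¹ * (l:ℂ)⁻¹) * (Z k ω * (starRingEnd ℂ) (Z l ω)) := by
    intro ω
    push_cast
    rw [← Complex.mul_conj', asA, map_sum, Finset.sum_mul_sum]
    refine Finset.sum_congr rfl fun k _ => Finset.sum_congr rfl fun l _ => ?_
    simp only [hZ, map_mul, map_inv₀, map_natCast]
    ring
  have e2 : ((∫ ω, ‖asA (fun k => G k ω) t n‖ ^ 2 ∂μ : ℝ) : ℂ) =
      ∑ k ∈ Finset.Icc 1 n, ∑ l ∈ Finset.Icc 1 n,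
        ((k:ℂ)⁻¹ * (l:ℂ)⁻¹) * ∫ ω, Z k ω * (starRingEnd ℂ) (Z l ω) ∂μ := by
    rw [← integral_complex_ofReal]
    refine (integral_congr_ae (ae_of_all _ e1)).trans ?_
    rw [integral_finsetSum _ fun k _ => integrable_finsetSum _ fun l _ => (hInt k l).const_mul _]
    refine Finset.sum_congr rfl fun k _ => ?_
    rw [integral_finsetSum _ fun l _ => (hInt k l).const_mul _]
    refine Finset.sum_congr rfl fun l _ => ?_
    rw [integral_const_mul]
  have e3 : ∫ ω, ‖asA (fun k => G k ω) t n‖ ^ 2 ∂μ =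
      ‖((∫ ω, ‖asA (fun k => G k ω) t n‖ ^ 2 ∂μ : ℝ) : ℂ)‖ := by
    rw [Complex.norm_real, Real.norm_of_nonneg]
    exact integral_nonneg fun ω => by positivity
  rw [e3, e2, Finset.mul_sum]
  refine norm_sum_le_of_le _ fun k _ => ?_
  rw [Finset.mul_sum]
  refine norm_sum_le_of_le _ fun l _ => ?_
  rw [norm_mul, norm_mul, norm_inv, norm_inv, Complex.norm_natCast, Complex.norm_natCast]
  calc _ ≤ ((k:ℝ)⁻¹ * (l:ℝ)⁻¹) * (t ^ 2 * |∫ ω, G k ω * G l ω ∂μ|) := by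
        gcongr; exact hcov k l
    _ = _ := by rw [div_eq_mul_inv, mul_inv]; ring

lemma aux_summable (S : ℕ → ℝ) (hS : ∀ n, 0 ≤ S n) (C : ℝ)
    (hC : ∀ N : ℕ, ∑ n ∈ Finset.Icc 2 N, (1 / ((n : ℝ) * (Real.log n) ^ 3)) * S n ≤ C) :
    Summable (fun n : ℕ => (1 / ((n : ℝ) * (Real.log n) ^ 3)) * S n) := by
  have hpos : ∀ n : ℕ, 0 ≤ 1 / ((n : ℝ) * (Real.log n) ^ 3) := by
    intro n
    have : 0 ≤ Real.log (n:ℝ) := Real.log_natCast_nonneg n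
    positivity
  refine summable_of_sum_range_le (c := C) (fun n => mul_nonneg (hpos n) (hS n)) ?_
  intro N
  refine le_trans ?_ (hC N)
  rw [← Finset.sum_filter_ne_zero]
  refine Finset.sum_le_sum_of_subset_of_nonneg ?_
    (fun n _ _ => mul_nonneg (hpos n) (hS n))
  intro n hn'
  obtain ⟨hn, hne⟩ := Finset.mem_filter.1 hn'
  rw [Finset.mem_Icc]
  refine ⟨?_, (Finset.mem_range.1 hn).le⟩
  by_contra hlt
  apply hne
  have : n = 0 ∨ n = 1 := by omega
  rcases this with rfl | rfl <;> simp

lemma aux_weighted {Ω : Type*} {mΩ : MeasurableSpace Ω} (μ : Measure Ω)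
    (F : ℕ → Ω → ℝ) (hF0 : ∀ n ω, 0 ≤ F n ω) (hF : ∀ n, Integrable (F n) μ)
    (w : ℕ → ℝ) (hw : ∀ n, 0 ≤ w n) (S : ℕ → ℝ) (c : ℝ)
    (hS : ∀ n, ∫ ω, F n ω ∂μ ≤ c * S n) (hs : Summable (fun n => w n * S n)) :
    ∀ᵐ ω ∂μ, Summable (fun n => w n * F n ω) := by
  refine aux_ae_summable μ (fun n ω => w n * F n ω)
    (fun n ω => mul_nonneg (hw n) (hF0 n ω)) (fun n => (hF n).const_mul _) ?_
  refine Summable.of_nonneg_of_le (fun n => integral_nonneg fun ω =>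
      mul_nonneg (hw n) (hF0 n ω)) ?_ (hs.mul_left c)
  intro n
  rw [integral_const_mul, mul_left_comm]
  exact mul_le_mul_of_nonneg_left (hS n) (hw n)

lemma asA_sq_integrable {Ω : Type*} {mΩ : MeasurableSpace Ω} (μ : Measure Ω)
    [IsProbabilityMeasure μ] (G : ℕ → Ω → ℝ) (hGmeas : ∀ n, Measurable (G n)) (t : ℝ) (n : ℕ) :
    Integrable (fun ω => ‖asA (fun k => G k ω) t n‖ ^ 2) μ := by
  have hmeas : Measurable (fun ω => asA (fun k => G k ω) t n) := by
    unfold asA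
    fun_prop
  refine Integrable.of_bound (hmeas.norm.pow_const 2).aestronglyMeasurable
    ((2 * ∑ k ∈ Finset.Icc 1 n, (k : ℝ)⁻¹) ^ 2) (ae_of_all _ fun ω => ?_)
  rw [Real.norm_of_nonneg (sq_nonneg _)]
  exact pow_le_pow_left₀ (norm_nonneg _) (asA_bound _ _ _) 2

lemma asA_ae {Ω : Type*} {mΩ : MeasurableSpace Ω} (μ : Measure Ω) [IsProbabilityMeasure μ]
    (G : ℕ → Ω → ℝ) (hGmeas : ∀ n, Measurable (G n))
    (hGauss : ∀ (s : Finset ℕ) (a : ℕ → ℝ), ∃ v : NNReal,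
      Measure.map (fun ω => ∑ i ∈ s, a i * G i ω) μ = gaussianReal 0 v)
    (hvar : ∀ n, ∫ ω, (G n ω) ^ 2 ∂μ = 1)
    (hA2 : ∃ C : ℝ, ∀ N : ℕ, ∑ n ∈ Finset.Icc 2 N,
      (1 / ((n : ℝ) * (Real.log n) ^ 3)) *
        ∑ k ∈ Finset.Icc 1 n, ∑ l ∈ Finset.Icc 1 n,
          |∫ ω, G k ω * G l ω ∂μ| / ((k : ℝ) * (l : ℝ)) ≤ C) (t : ℝ) :
    ∀ᵐ ω ∂μ, Tendsto (fun n : ℕ => ‖asA (fun k => G k ω) t n‖ / Real.log n) atTop (𝓝 0) := by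
  obtain ⟨C, hC⟩ := hA2
  have hpos : ∀ n : ℕ, 0 ≤ 1 / ((n : ℝ) * (Real.log n) ^ 3) := by
    intro n
    have : 0 ≤ Real.log (n:ℝ) := Real.log_natCast_nonneg n
    positivity
  have hS0 : ∀ n : ℕ, 0 ≤ ∑ k ∈ Finset.Icc 1 n, ∑ l ∈ Finset.Icc 1 n,
          |∫ ω, G k ω * G l ω ∂μ| / ((k : ℝ) * (l : ℝ)) := fun n => by positivity
  have hsq := asA_sq_integral μ G hGmeas hGauss hvar t
  have hs := aux_summable _ hS0 C hC
  have hInt : ∀ n, Integrable (fun ω => ‖asA (fun k => G k ω) t n‖ ^ 2) μ :=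
    fun n => asA_sq_integrable μ G hGmeas t n
  have h := aux_weighted μ (fun n ω => ‖asA (fun k => G k ω) t n‖ ^ 2)
    (fun n ω => sq_nonneg _) hInt (fun n : ℕ => 1 / ((n : ℝ) * (Real.log n) ^ 3)) hpos _
    (t ^ 2) hsq hs
  filter_upwards [h] with ω hω
  exact asA_det (fun k => G k ω) t hω

/-- Equicontinuity estimate for characteristic functions. -/
lemma aux_charFun_diff (ν : Measure ℝ) [IsProbabilityMeasure ν] (t h : ℝ) :
    ‖charFun ν t - charFun ν (t + h)‖ ^ 2 ≤ 2 * (1 - (charFun ν h).re) := by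
  set u : ℝ → ℝ := fun x => ‖1 - Complex.exp (h * x * Complex.I)‖ with hu
  have hum : Measurable u := by simp only [hu]; fun_prop
  have hub : ∀ x, u x ≤ 2 := fun x => by
    refine (norm_sub_le _ _).trans ?_
    rw [← Complex.ofReal_mul, Complex.norm_exp_ofReal_mul_I, norm_one]
    norm_num
  have hu0 : ∀ x, 0 ≤ u x := fun x => norm_nonneg _
  have huL : MemLp u 2 ν := MemLp.of_bound hum.aestronglyMeasurable 2
    (ae_of_all _ fun x => by rw [Real.norm_of_nonneg (hu0 x)]; exact hub x)
  have hi : ∀ s : ℝ, Integrable (fun x : ℝ => Complex.exp (s * x * Complex.I)) ν :=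
    fun s => aux_int ν (fun x => x) measurable_id s
  have h1 : ‖charFun ν t - charFun ν (t + h)‖ ≤ ∫ x, u x ∂ν := by
    rw [charFun_apply_real, charFun_apply_real, ← integral_sub (hi _) (hi _)]
    refine norm_integral_le_of_norm_le (huL.integrable (by norm_num)) (ae_of_all _ fun x => ?_)
    have : Complex.exp (t * x * Complex.I) - Complex.exp ((t + h : ℝ) * x * Complex.I) =
      Complex.exp (t * x * Complex.I) * (1 - Complex.exp (h * x * Complex.I)) := by
      rw [mul_sub, ← Complex.exp_add]; push_cast; ring_nf
    rw [this, norm_mul, ← Complex.ofReal_mul, Complex.norm_exp_ofReal_mul_I, one_mul]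
  have h2 : (∫ x, u x ∂ν) ^ 2 ≤ ∫ x, u x ^ 2 ∂ν := by
    have := variance_nonneg u ν
    rw [variance_eq_sub huL] at this
    simp only [Pi.pow_apply] at this
    linarith
  have h3 : ∀ x, u x ^ 2 = 2 * (1 - (Complex.exp (h * x * Complex.I)).re) := by
    intro x
    simp only [hu]
    rw [← Complex.normSq_eq_norm_sq, ← Complex.ofReal_mul, Complex.normSq_apply]
    simp only [Complex.sub_re, Complex.sub_im, Complex.one_re, Complex.one_im,
      Complex.exp_ofReal_mul_I_re, Complex.exp_ofReal_mul_I_im]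
    nlinarith [Real.sin_sq_add_cos_sq (h * x)]
  have h4 : ∫ x, u x ^ 2 ∂ν = 2 * (1 - (charFun ν h).re) := by
    simp_rw [h3]
    have hre : Integrable (fun x : ℝ => (Complex.exp (h * x * Complex.I)).re) ν := (hi h).re
    rw [integral_const_mul, integral_sub (integrable_const _) hre, charFun_apply_real]
    have : ∫ x : ℝ, (Complex.exp (h * x * Complex.I)).re ∂ν
        = (∫ x : ℝ, Complex.exp (h * x * Complex.I) ∂ν).re :=
      integral_re (hi h)
    rw [this]
    simp
  rw [← h4]
  exact (pow_le_pow_left₀ (norm_nonneg _) h1 2).trans h2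

/-- Upgrading almost everywhere convergence of characteristic functions. -/
lemma aux_charFun_ae (ν : ℕ → Measure ℝ) [∀ n, IsProbabilityMeasure (ν n)]
    (f : ℝ → ℂ) (hf : Continuous f) (hf0 : f 0 = 1)
    (h : ∀ᵐ t : ℝ, Tendsto (fun n => charFun (ν n) t) atTop (𝓝 (f t))) (t : ℝ) :
    Tendsto (fun n => charFun (ν n) t) atTop (𝓝 (f t)) := by
  rw [Metric.tendsto_atTop']
  intro ε hε
  have hd : Dense {s : ℝ | Tendsto (fun n => charFun (ν n) s) atTop (𝓝 (f s)) ∧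
      Tendsto (fun n => charFun (ν n) (t + s)) atTop (𝓝 (f (t + s)))} := by
    apply Measure.dense_of_ae (μ := volume)
    exact h.and ((eventually_add_left_iff volume t (p := fun s =>
      Tendsto (fun n => charFun (ν n) s) atTop (𝓝 (f s)))).2 h)
  have n1 : ∀ᶠ s in 𝓝 (0:ℝ), 2 * (1 - (f s).re) < (ε/3)^2 := by
    have : Tendsto (fun s => 2 * (1 - (f s).re)) (𝓝 0) (𝓝 (2 * (1 - (f 0).re))) :=
      (by fun_prop : Continuous (fun s => 2 * (1 - (f s).re))).tendsto 0
    rw [hf0] at this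
    refine this.eventually (gt_mem_nhds ?_)
    simp; positivity
  have n2 : ∀ᶠ s in 𝓝 (0:ℝ), ‖f (t + s) - f t‖ < ε/3 := by
    have : Tendsto (fun s => ‖f (t + s) - f t‖) (𝓝 0) (𝓝 (‖f (t + 0) - f t‖)) :=
      (by fun_prop : Continuous (fun s => ‖f (t + s) - f t‖)).tendsto 0
    refine this.eventually (gt_mem_nhds ?_)
    simp; positivity
  obtain ⟨s, ⟨hs1, hs2⟩, hs3, hs4⟩ := hd.inter_nhds_nonempty (n1.and n2)
  have m1 : ∀ᶠ n in atTop, 2 * (1 - (charFun (ν n) s).re) < (ε/3)^2 := by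
    have : Tendsto (fun n => 2 * (1 - (charFun (ν n) s).re)) atTop (𝓝 (2 * (1 - (f s).re))) :=
      ((by fun_prop : Continuous (fun z : ℂ => 2 * (1 - z.re))).tendsto (f s)).comp hs1
    exact this.eventually (gt_mem_nhds hs3)
  have m2 : ∀ᶠ n in atTop, ‖charFun (ν n) (t + s) - f (t + s)‖ < ε/3 := by
    have := Metric.tendsto_nhds.1 hs2 (ε/3) (by positivity)
    simpa only [dist_eq_norm] using this
  obtain ⟨N, hN⟩ := eventually_atTop.1 (m1.and m2)
  refine ⟨N, fun n hn => ?_⟩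
  obtain ⟨k1, k2⟩ := hN n hn.le
  have k3 : ‖charFun (ν n) t - charFun (ν n) (t + s)‖ < ε / 3 :=
    lt_of_pow_lt_pow_left₀ 2 (by positivity) ((aux_charFun_diff (ν n) t s).trans_lt k1)
  rw [dist_eq_norm]
  calc ‖charFun (ν n) t - f t‖ = ‖(charFun (ν n) t - charFun (ν n) (t + s)) +
        (charFun (ν n) (t + s) - f (t + s)) + (f (t + s) - f t)‖ := by congr 1; ring
    _ ≤ _ := norm_add₃_le
    _ < ε := by linarith

/-- The logarithmic empirical measures. -/
noncomputable def asNu (x : ℕ → ℝ) (n : ℕ) : Measure ℝ :=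
  ∑ k ∈ Finset.Icc 1 (n+1),
    ENNReal.ofReal ((k:ℝ)⁻¹ / ∑ j ∈ Finset.Icc 1 (n+1), (j:ℝ)⁻¹) • Measure.dirac (x k)

lemma aux_Hpos (n : ℕ) : 0 < ∑ j ∈ Finset.Icc 1 (n+1), (j:ℝ)⁻¹ := by
  apply Finset.sum_pos
  · intro i hi
    have : 0 < i := (Finset.mem_Icc.1 hi).1
    positivity
  · exact ⟨1, by simp⟩

instance asNu_prob (x : ℕ → ℝ) (n : ℕ) : IsProbabilityMeasure (asNu x n) := by
  constructor
  have := aux_Hpos n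
  simp only [asNu, Measure.coe_finsetSum, Finset.sum_apply, Measure.smul_apply, measure_univ,
    smul_eq_mul, mul_one]
  rw [← ENNReal.ofReal_sum_of_nonneg (fun i _ => by positivity), ← Finset.sum_div,
    div_self this.ne', ENNReal.ofReal_one]

lemma asNu_integral {E : Type*} [NormedAddCommGroup E] [NormedSpace ℝ E] [CompleteSpace E]
    (x : ℕ → ℝ) (n : ℕ) (g : ℝ → E) :
    ∫ y, g y ∂(asNu x n) = (∑ j ∈ Finset.Icc 1 (n+1), (j:ℝ)⁻¹)⁻¹ •
      ∑ k ∈ Finset.Icc 1 (n+1), (k:ℝ)⁻¹ • g (x k) := by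
  have := aux_Hpos n
  rw [asNu, integral_finsetSum_measure, Finset.smul_sum]
  · refine Finset.sum_congr rfl fun k _ => ?_
    rw [integral_smul_measure, integral_dirac, ENNReal.toReal_ofReal (by positivity), smul_smul,
      div_eq_inv_mul]
  · intro k _
    refine Integrable.smul_measure ?_ ENNReal.ofReal_ne_top
    exact integrable_dirac (by simp)

lemma aux_H_log : Tendsto (fun n : ℕ => (∑ j ∈ Finset.Icc 1 n, (j:ℝ)⁻¹) / Real.log n)
    atTop (𝓝 1) := by
  have hl : Tendsto (fun n : ℕ => Real.log n) atTop atTop :=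
    Real.tendsto_log_atTop.comp tendsto_natCast_atTop_atTop
  have h := (Real.tendsto_harmonic_sub_log.div_atTop hl).add_const 1
  rw [zero_add] at h
  refine h.congr' ?_
  filter_upwards [hl.eventually_gt_atTop 0] with n hn
  rw [← aux_H]
  field_simp
  ring

lemma aux_final (x : ℕ → ℝ)
    (h : ∀ᵐ t : ℝ, Tendsto (fun n : ℕ => ‖asA x t n‖ / Real.log n) atTop (𝓝 0))
    (φ : BoundedContinuousFunction ℝ ℝ) :
    Tendsto (fun n : ℕ => (Real.log n)⁻¹ * ∑ k ∈ Finset.Icc 1 n, (k : ℝ)⁻¹ * φ (x k))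
        atTop (𝓝 (∫ x, φ x ∂(gaussianReal 0 1))) := by
  have hcf : ∀ t : ℝ, charFun (gaussianReal 0 1) t = Complex.exp (-(t^2/2)) := by
    intro t
    rw [charFun_gaussianReal]; simp
  have hconv : ∀ t : ℝ, Tendsto (fun n => charFun (asNu x n) t) atTop
      (𝓝 (Complex.exp (-((t:ℂ)^2/2)))) := by
    refine aux_charFun_ae (asNu x) (fun t : ℝ => Complex.exp (-((t:ℂ)^2/2))) (by fun_prop)
      (by simp) ?_
    filter_upwards [h] with t ht
    have e : ∀ n, charFun (asNu x n) t - Complex.exp (-((t:ℂ)^2/2)) =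
        ((∑ j ∈ Finset.Icc 1 (n+1), (j:ℝ)⁻¹)⁻¹ : ℝ) • asA x t (n+1) := by
      intro n
      rw [charFun_apply_real, asNu_integral, asA]
      simp_rw [mul_sub]
      rw [Finset.sum_sub_distrib, smul_sub]
      congr 1
      · simp
      · rw [← Finset.sum_mul]
        have := (aux_Hpos n).ne'
        rw [Complex.real_smul, ← mul_assoc]
        have h2 : ∑ i ∈ Finset.Icc 1 (n+1), ((i:ℂ))⁻¹
            = ((∑ i ∈ Finset.Icc 1 (n+1), ((i:ℝ))⁻¹ : ℝ) : ℂ) := by push_cast; rfl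
        rw [h2, ← Complex.ofReal_mul, inv_mul_cancel₀ this]
        simp
    rw [tendsto_iff_norm_sub_tendsto_zero]
    simp_rw [e]
    have h3 := (ht.div aux_H_log one_ne_zero).comp (tendsto_add_atTop_nat 1)
    rw [zero_div] at h3
    refine h3.congr' ?_
    filter_upwards [eventually_ge_atTop 1] with n hn
    have hn' : (1:ℝ) ≤ n := by exact_mod_cast hn
    have hl : 0 < Real.log ((n+1 : ℕ):ℝ) := Real.log_pos (by push_cast; linarith)
    have := aux_Hpos n
    simp only [Function.comp, Pi.div_apply]
    rw [norm_smul, Real.norm_of_nonneg (by positivity)]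
    field_simp
  let P : ℕ → ProbabilityMeasure ℝ := fun n => ⟨asNu x n, asNu_prob x n⟩
  let P0 : ProbabilityMeasure ℝ := ⟨gaussianReal 0 1, inferInstance⟩
  have hw : Tendsto P atTop (𝓝 P0) := by
    refine ProbabilityMeasure.tendsto_of_tendsto_charFun (E := ℝ) ?_
    intro t
    simp only [P, P0, ProbabilityMeasure.coe_mk, hcf]
    exact hconv t
  have hφ := ProbabilityMeasure.tendsto_iff_forall_integral_tendsto.1 hw φ
  simp only [P, P0, ProbabilityMeasure.coe_mk, asNu_integral] at hφ
  rw [← tendsto_add_atTop_iff_nat 1]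
  have h4 := (aux_H_log.comp (tendsto_add_atTop_nat 1)).mul hφ
  rw [one_mul] at h4
  refine h4.congr fun n => ?_
  have := (aux_Hpos n).ne'
  simp only [Function.comp, smul_eq_mul]
  rw [div_eq_inv_mul, mul_assoc, mul_inv_cancel_left₀ this]


/-- ASCLT for a centered Gaussian sequence with unit variances: if
`Σ_{n≥2} (1/(n log³ n)) Σ_{k,l=1}^n |E[G_k G_l]|/(kl) < ∞`, then almost surely, for every
bounded continuous `φ`, `(1/log n) Σ_{k=1}^n (1/k) φ(G_k) → E[φ(N)]`, `N` standard Gaussian. -/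
theorem stmt1
    {Ω : Type*} {mΩ : MeasurableSpace Ω} (μ : Measure Ω) [IsProbabilityMeasure μ]
    (G : ℕ → Ω → ℝ) (hGmeas : ∀ n, Measurable (G n))
    -- every finite real-linear combination of the `G_n` is centered Gaussian
    (hGauss : ∀ (s : Finset ℕ) (a : ℕ → ℝ), ∃ v : NNReal,
      Measure.map (fun ω => ∑ i ∈ s, a i * G i ω) μ = gaussianReal 0 v)
    (hmean : ∀ n, ∫ ω, G n ω ∂μ = 0)
    (hvar : ∀ n, ∫ ω, (G n ω) ^ 2 ∂μ = 1)
    -- condition `(A₂')`: `Σ_{n≥2} (1/(n log³ n)) Σ_{k,l=1}^n |E[G_k G_l]|/(kl) < ∞`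
    (hA2 : ∃ C : ℝ, ∀ N : ℕ, ∑ n ∈ Finset.Icc 2 N,
      (1 / ((n : ℝ) * (Real.log n) ^ 3)) *
        ∑ k ∈ Finset.Icc 1 n, ∑ l ∈ Finset.Icc 1 n,
          |∫ ω, G k ω * G l ω ∂μ| / ((k : ℝ) * (l : ℝ)) ≤ C) :
    -- ASCLT
    ∀ᵐ ω ∂μ, ∀ φ : BoundedContinuousFunction ℝ ℝ,
      Tendsto (fun n : ℕ => (Real.log n)⁻¹ * ∑ k ∈ Finset.Icc 1 n, (k : ℝ)⁻¹ * φ (G k ω))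
        atTop (𝓝 (∫ x, φ x ∂(gaussianReal 0 1))) := by
  have hm : MeasurableSet {p : ℝ × Ω | Tendsto
      (fun n : ℕ => ‖asA (fun k => G k p.2) p.1 n‖ / Real.log n) atTop (𝓝 0)} := by
    refine measurableSet_tendsto _ fun n => ?_
    have := (asA_measurable G hGmeas n).comp (measurable_swap (α := ℝ) (β := Ω))
    exact this.norm.div_const _
  have h1 : ∀ᵐ t : ℝ, ∀ᵐ ω ∂μ,
      Tendsto (fun n : ℕ => ‖asA (fun k => G k ω) t n‖ / Real.log n) atTop (𝓝 0) :=
    ae_of_all _ fun t => asA_ae μ G hGmeas hGauss hvar hA2 t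
  have h2 := (Measure.ae_ae_comm (p := fun (t : ℝ) (ω : Ω) =>
    Tendsto (fun n : ℕ => ‖asA (fun k => G k ω) t n‖ / Real.log n) atTop (𝓝 0)) hm).1 h1
  filter_upwards [h2] with ω hω φ
  exact aux_final (fun k => G k ω) hω φ
end

section
/- Let q ≥ 1 be an integer and let (X, Y) be a pair of real random variables such that every real-linear combination aX + bY has a centered Gaussian distribution, with E[X²] = E[Y²] = 1 and E[XY] = c. Then E[H_q(X) H_q(Y)] = q! · c^q. -/
open MeasureTheory ProbabilityTheory

lemma aux_integrable_poly (v : NNReal) (P : Polynomial ℝ) :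
    Integrable (fun x => P.eval x) (gaussianReal 0 v) := by
  induction P using Polynomial.induction_on' with
  | add p q hp hq => simpa [Pi.add_def] using hp.add hq
  | monomial n a =>
    simp only [Polynomial.eval_monomial]
    apply Integrable.const_mul
    have h := integrable_pow_of_mem_interior_integrableExpSet
      (X := id) (μ := gaussianReal 0 v) (by simp [integrableExpSet_id_gaussianReal]) n
    simpa using h

lemma aux_integrable_mul {Ω : Type*} {mΩ : MeasurableSpace Ω} {μ : Measure Ω}
    {A B : Ω → ℝ} {v w : NNReal} (hA : Measurable A) (hB : Measurable B)
    (hAl : μ.map A = gaussianReal 0 v) (hBl : μ.map B = gaussianReal 0 w)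
    (P Q : Polynomial ℝ) :
    Integrable (fun ω => P.eval (A ω) * Q.eval (B ω)) μ := by
  have key : ∀ (C : Ω → ℝ) (u : NNReal), Measurable C → μ.map C = gaussianReal 0 u →
      ∀ P : Polynomial ℝ, MemLp (fun ω => P.eval (C ω)) 2 μ := by
    intro C u hC hCl P
    have hm : Measurable (fun ω => P.eval (C ω)) := P.continuous.measurable.comp hC
    rw [memLp_two_iff_integrable_sq hm.aestronglyMeasurable]
    have h := aux_integrable_poly u (P ^ 2)
    rw [← hCl] at h
    simpa [Function.comp_def] using h.comp_measurable hC
  exact (key A v hA hAl P).integrable_mul (key B w hB hBl Q)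

lemma aux_stein (P : Polynomial ℝ) :
    ∫ x, (x * P.eval x - P.derivative.eval x) ∂(gaussianReal 0 1) = 0 := by
  have hi : ∀ Q : Polynomial ℝ, Integrable (fun x => gaussianPDFReal 0 1 x * Q.eval x) := by
    intro Q
    have h := aux_integrable_poly 1 Q
    rw [gaussianReal_of_var_ne_zero _ one_ne_zero,
      integrable_withDensity_iff_integrable_smul' (measurable_gaussianPDF _ _)
        (ae_of_all _ fun _ ↦ gaussianPDF_lt_top)] at h
    simpa using h
  rw [integral_gaussianReal_eq_integral_smul one_ne_zero]
  have h := integral_eq_zero_of_hasDerivAt_of_integrable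
    (f := fun x => gaussianPDFReal 0 1 x * P.eval x)
    (f' := fun x => gaussianPDFReal 0 1 x * (Polynomial.derivative P - Polynomial.X * P).eval x)
    ?_ (hi _) (hi _)
  · rw [← neg_eq_zero, ← integral_neg]
    refine Eq.trans ?_ h
    congr 1
    ext x
    simp
    ring
  · intro x
    have h1 : HasDerivAt (gaussianPDFReal 0 1) (gaussianPDFReal 0 1 x * (-x)) x := by
      have h2 : HasDerivAt (fun x : ℝ => -(x - 0) ^ 2 / (2 * ((1 : NNReal) : ℝ))) (-x) x := by
        have := (((hasDerivAt_id x).sub_const 0).pow 2).neg.div_const (2 * ((1 : NNReal) : ℝ))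
        convert! this using 1
        simp
        ring
      have := h2.exp.const_mul ((√(2 * Real.pi * ((1 : NNReal) : ℝ)))⁻¹)
      rw [gaussianPDFReal_def]
      convert! this using 1
      ring
    convert! h1.mul (P.hasDerivAt x) using 1
    simp
    ring

/-- Real Hermite polynomial. -/
noncomputable def auxH (q : ℕ) : Polynomial ℝ :=
  (Polynomial.hermite q).map (Int.castRingHom ℝ)

lemma auxH_succ (q : ℕ) :
    auxH (q + 1) = Polynomial.X * auxH q - Polynomial.derivative (auxH q) := by
  simp [auxH, Polynomial.hermite_succ, Polynomial.derivative_map]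

lemma auxH_iter (q : ℕ) :
    Polynomial.derivative^[q] (auxH q) = Polynomial.C (q.factorial : ℝ) := by
  have hd : (auxH q).natDegree ≤ q := by
    refine Polynomial.natDegree_map_le.trans ?_
    simp
  have h0 : (Polynomial.derivative^[q] (auxH q)).natDegree = 0 := by
    have := Polynomial.natDegree_iterate_derivative (auxH q) q
    omega
  rw [Polynomial.eq_C_of_natDegree_eq_zero h0, Polynomial.coeff_iterate_derivative]
  simp [auxH, Nat.descFactorial_self]

lemma aux_law (a b : ℝ) :
    ((gaussianReal 0 1).prod (gaussianReal 0 1)).map (fun z : ℝ × ℝ => a * z.1 + b * z.2)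
      = gaussianReal 0 (Real.toNNReal (a ^ 2 + b ^ 2)) := by
  have h1 : ((gaussianReal 0 1).prod (gaussianReal 0 1)).map (fun z : ℝ × ℝ => a * z.1)
      = gaussianReal 0 (Real.toNNReal (a ^ 2)) := by
    have : (fun z : ℝ × ℝ => a * z.1) = (fun x => a * x) ∘ Prod.fst := rfl
    rw [this, ← Measure.map_map (by fun_prop) measurable_fst, Measure.map_fst_prod,
      measure_univ, one_smul, gaussianReal_map_const_mul]
    congr 1
    · simp
    · ext; simp [sq_nonneg]
  have h2 : ((gaussianReal 0 1).prod (gaussianReal 0 1)).map (fun z : ℝ × ℝ => b * z.2)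
      = gaussianReal 0 (Real.toNNReal (b ^ 2)) := by
    have : (fun z : ℝ × ℝ => b * z.2) = (fun x => b * x) ∘ Prod.snd := rfl
    rw [this, ← Measure.map_map (by fun_prop) measurable_snd, Measure.map_snd_prod,
      measure_univ, one_smul, gaussianReal_map_const_mul]
    congr 1
    · simp
    · ext; simp [sq_nonneg]
  have h := gaussianReal_add_gaussianReal_of_indepFun
    (indepFun_prod (μ := gaussianReal 0 1) (ν := gaussianReal 0 1)
      (X := fun x : ℝ => a * x) (Y := fun x : ℝ => b * x) (by fun_prop) (by fun_prop)) h1 h2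
  rw [Real.toNNReal_add (sq_nonneg a) (sq_nonneg b)]
  simpa [Pi.add_def] using h

lemma aux_step (c s : ℝ) (m : ℕ) (P : Polynomial ℝ) :
    ∫ z : ℝ × ℝ, (auxH (m + 1)).eval z.1 * P.eval (c * z.1 + s * z.2)
        ∂((gaussianReal 0 1).prod (gaussianReal 0 1))
      = c * ∫ z : ℝ × ℝ, (auxH m).eval z.1 * P.derivative.eval (c * z.1 + s * z.2)
        ∂((gaussianReal 0 1).prod (gaussianReal 0 1)) := by
  have hint : ∀ Q R : Polynomial ℝ, Integrable
      (fun z : ℝ × ℝ => Q.eval z.1 * R.eval (c * z.1 + s * z.2))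
      ((gaussianReal 0 1).prod (gaussianReal 0 1)) := by
    intro Q R
    refine aux_integrable_mul (v := 1) measurable_fst (by fun_prop) ?_ (aux_law c s) Q R
    simp [Measure.map_fst_prod]
  rw [← sub_eq_zero, ← integral_const_mul, ← integral_sub (hint _ _) ((hint _ _).const_mul _)]
  refine (integral_prod_symm _ ((hint _ _).sub ((hint _ _).const_mul _))).trans ?_
  refine integral_eq_zero_of_ae (ae_of_all _ fun y => ?_)
  have h := aux_stein (auxH m * P.comp (Polynomial.C c * Polynomial.X + Polynomial.C (s * y)))
  simp only [Pi.zero_apply]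
  refine Eq.trans ?_ h
  congr 1
  ext x
  simp [auxH_succ, Polynomial.derivative_comp]
  ring

lemma aux_main (c s : ℝ) (m : ℕ) : ∀ P : Polynomial ℝ,
    ∫ z : ℝ × ℝ, (auxH m).eval z.1 * P.eval (c * z.1 + s * z.2)
        ∂((gaussianReal 0 1).prod (gaussianReal 0 1))
      = c ^ m * ∫ z : ℝ × ℝ, (Polynomial.derivative^[m] P).eval (c * z.1 + s * z.2)
        ∂((gaussianReal 0 1).prod (gaussianReal 0 1)) := by
  induction m with
  | zero => intro P; simp [auxH]
  | succ m ih =>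
    intro P
    rw [aux_step, ih, Function.iterate_succ_apply, pow_succ]
    ring


/-- For a centered jointly Gaussian pair `(X, Y)` with unit variances and covariance `c`,
and any integer `q ≥ 1`, one has `E[H_q(X) H_q(Y)] = q! c^q`, where `H_q` is the `q`-th
probabilists' Hermite polynomial. -/
theorem stmt10
    {Ω : Type*} {mΩ : MeasurableSpace Ω} (μ : Measure Ω) [IsProbabilityMeasure μ]
    (q : ℕ) (hq : 1 ≤ q)
    (X Y : Ω → ℝ) (hX : Measurable X) (hY : Measurable Y) (c : ℝ)
    -- every real-linear combination `aX + bY` is centered Gaussian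
    (hGauss : ∀ a b : ℝ, ∃ v : NNReal,
      Measure.map (fun ω => a * X ω + b * Y ω) μ = gaussianReal 0 v)
    (hvarX : ∫ ω, (X ω) ^ 2 ∂μ = 1) (hvarY : ∫ ω, (Y ω) ^ 2 ∂μ = 1)
    (hcov : ∫ ω, X ω * Y ω ∂μ = c) :
    ∫ ω, (Polynomial.aeval (X ω) (Polynomial.hermite q) : ℝ) *
        (Polynomial.aeval (Y ω) (Polynomial.hermite q) : ℝ) ∂μ
      = (q.factorial : ℝ) * c ^ q := by
  have hmem : ∀ Z : Ω → ℝ, Measurable Z → (∃ v : NNReal, Measure.map Z μ = gaussianReal 0 v) →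
      MemLp Z 2 μ := by
    rintro Z hZ ⟨v, hv⟩
    have h := memLp_id_gaussianReal (μ := 0) (v := v) 2
    rw [← hv] at h
    exact h.comp_of_map hZ.aemeasurable
  have hX2 : MemLp X 2 μ := hmem X hX (by simpa using hGauss 1 0)
  have hY2 : MemLp Y 2 μ := hmem Y hY (by simpa using hGauss 0 1)
  -- second moment of a linear combination
  have hmom : ∀ a b : ℝ, ∫ ω, (a * X ω + b * Y ω) ^ 2 ∂μ = a ^ 2 + 2 * a * b * c + b ^ 2 := by
    intro a b
    have e : (fun ω => (a * X ω + b * Y ω) ^ 2) =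
        fun ω => (a ^ 2 * X ω ^ 2 + (2 * a * b) * (X ω * Y ω)) + b ^ 2 * Y ω ^ 2 := by
      ext ω; ring
    have i1 : Integrable (fun ω => a ^ 2 * X ω ^ 2) μ := hX2.integrable_sq.const_mul _
    have i2 : Integrable (fun ω => (2 * a * b) * (X ω * Y ω)) μ :=
      (hX2.integrable_mul hY2).const_mul _
    have i12 : Integrable (fun ω => a ^ 2 * X ω ^ 2 + (2 * a * b) * (X ω * Y ω)) μ := i1.add i2
    have i3 : Integrable (fun ω => b ^ 2 * Y ω ^ 2) μ := hY2.integrable_sq.const_mul _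
    rw [e, integral_add i12 i3, integral_add i1 i2, integral_const_mul,
      integral_const_mul, integral_const_mul, hvarX, hvarY, hcov]
    ring
  have hlaw : ∀ a b : ℝ, Measure.map (fun ω => a * X ω + b * Y ω) μ
      = gaussianReal 0 (Real.toNNReal (a ^ 2 + 2 * a * b * c + b ^ 2)) := by
    intro a b
    obtain ⟨v, hv⟩ := hGauss a b
    rw [hv, ← hmom a b]
    congr 1
    have h1 : ∫ x, x ^ 2 ∂(gaussianReal 0 v) = v := by
      have h := variance_fun_id_gaussianReal (μ := 0) (v := v)
      rwa [variance_of_integral_eq_zero (by fun_prop) (by simp)] at h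
    rw [← hv, integral_map (by fun_prop) (by fun_prop)] at h1
    rw [h1, Real.toNNReal_coe]
  have hc : 0 ≤ 1 - c ^ 2 := by
    have h := hmom (-c) 1
    have h' : 0 ≤ ∫ ω, (-c * X ω + 1 * Y ω) ^ 2 ∂μ := integral_nonneg fun ω => sq_nonneg _
    rw [h] at h'
    nlinarith
  set s := √(1 - c ^ 2) with hs
  have hs2 : s ^ 2 = 1 - c ^ 2 := Real.sq_sqrt hc
  have hpair : μ.map (fun ω => (X ω, Y ω)) =
      ((gaussianReal 0 1).prod (gaussianReal 0 1)).map
        (fun z : ℝ × ℝ => (z.1, c * z.1 + s * z.2)) := by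
    have : IsProbabilityMeasure (μ.map (fun ω => (X ω, Y ω))) :=
      Measure.isProbabilityMeasure_map (by fun_prop)
    have : IsProbabilityMeasure (((gaussianReal 0 1).prod (gaussianReal 0 1)).map
        (fun z : ℝ × ℝ => (z.1, c * z.1 + s * z.2))) :=
      Measure.isProbabilityMeasure_map (by fun_prop)
    refine Measure.ext_of_charFunDual (funext fun L => ?_)
    have hL : ∀ x y : ℝ, L (x, y) = L (1, 0) * x + L (0, 1) * y := by
      intro x y
      have : ((x, y) : ℝ × ℝ) = x • (1, 0) + y • (0, 1) := by simp
      rw [this, map_add, map_smul, map_smul]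
      simp [mul_comm]
    rw [charFunDual_eq_charFun_map_one, charFunDual_eq_charFun_map_one,
      Measure.map_map (by fun_prop) (by fun_prop), Measure.map_map (by fun_prop) (by fun_prop)]
    congr 1
    have e1 : (L ∘ fun ω => (X ω, Y ω)) = fun ω => L (1, 0) * X ω + L (0, 1) * Y ω := by
      ext ω; exact hL _ _
    have e2 : (L ∘ fun z : ℝ × ℝ => (z.1, c * z.1 + s * z.2)) =
        fun z => (L (1, 0) + L (0, 1) * c) * z.1 + (L (0, 1) * s) * z.2 := by
      ext z
      simp only [Function.comp_apply]
      rw [hL]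
      ring
    rw [e1, e2, hlaw, aux_law]
    congr 2
    rw [mul_pow, hs2]
    ring
  have hev : ∀ x : ℝ, (Polynomial.aeval x (Polynomial.hermite q) : ℝ) = (auxH q).eval x := by
    intro x
    simp [auxH, Polynomial.aeval_def, Polynomial.eval_map]
  simp only [hev]
  have hcont : Continuous (fun z : ℝ × ℝ => (auxH q).eval z.1 * (auxH q).eval z.2) := by
    fun_prop
  have t1 : ∫ ω, (auxH q).eval (X ω) * (auxH q).eval (Y ω) ∂μ =
      ∫ z, (auxH q).eval z.1 * (auxH q).eval z.2 ∂(μ.map (fun ω => (X ω, Y ω))) := by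
    rw [integral_map (by fun_prop) hcont.aestronglyMeasurable]
  rw [t1, hpair, integral_map (by fun_prop) hcont.aestronglyMeasurable, aux_main, auxH_iter]
  simp [mul_comm]
end

section
/- Let q ≥ 2 be an integer, let H ∈ (0, 1 − 1/(2q)), and let (B_k)_{k∈ℕ} be a discrete fractional Brownian motion with Hurst index H. Set V_n = Σ_{k=0}^{n−1} H_q(B_{k+1} − B_k). Then E[V_n²]/n → q! Σ_{r∈ℤ} ρ_H(r)^q as n → ∞, and this limit is a finite positive real number. -/
open MeasureTheory ProbabilityTheory Filter Topology


lemma memLp_all_mul {Ω : Type*} {mΩ : MeasurableSpace Ω} {μ : Measure Ω} {f g : Ω → ℝ}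
    (hf : ∀ p : NNReal, MemLp f p μ) (hg : ∀ p : NNReal, MemLp g p μ) :
    ∀ p : NNReal, MemLp (fun ω => f ω * g ω) p μ := by
  intro p
  have hh : ENNReal.HolderTriple ((2 * p : NNReal) : ENNReal) ((2 * p : NNReal) : ENNReal) (p : ENNReal) := by
    constructor
    rw [← two_mul]
    push_cast
    rw [ENNReal.mul_inv (by simp) (by simp), ← mul_assoc, ENNReal.mul_inv_cancel (by simp) (by simp),
      one_mul]
  exact MemLp.mul' (hg (2 * p)) (hf (2 * p))

lemma memLp_all_poly {Ω : Type*} {mΩ : MeasurableSpace Ω} {μ : Measure Ω} [IsFiniteMeasure μ]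
    {f : Ω → ℝ} (hf : ∀ p : NNReal, MemLp f p μ) (P : Polynomial ℝ) :
    ∀ p : NNReal, MemLp (fun ω => P.eval (f ω)) p μ := by
  induction P using Polynomial.induction_on with
  | C a => intro p; simpa using memLp_const a
  | add P Q hP hQ => intro p; simp only [Polynomial.eval_add]; exact (hP p).add (hQ p)
  | monomial n a ih =>
    intro p
    have := memLp_all_mul ih hf p
    refine this.congr_norm ?_ ?_
    · have := this.1
      convert this using 2 with ω
      simp; ring
    · filter_upwards with ω
      congr 1
      simp; ring

lemma gauss_memLp_poly (v : NNReal) (P : Polynomial ℝ) (p : NNReal) :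
    MemLp (fun x => P.eval x) p (gaussianReal 0 v) :=
  memLp_all_poly (f := id) (fun p => memLp_id_gaussianReal p) P p

lemma stein_poly (P : Polynomial ℝ) :
    ∫ x, x * P.eval x ∂(gaussianReal 0 1) = ∫ x, P.derivative.eval x ∂(gaussianReal 0 1) := by
  have hi : ∀ Q : Polynomial ℝ, Integrable (fun x => gaussianPDFReal 0 1 x * Q.eval x) := by
    intro Q
    have h1 : Integrable (fun x => Q.eval x) (gaussianReal 0 1) :=
      memLp_one_iff_integrable.1 (by simpa using gauss_memLp_poly 1 Q 1)
    rw [gaussianReal_of_var_ne_zero _ one_ne_zero,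
      integrable_withDensity_iff_integrable_smul' (measurable_gaussianPDF _ _)
        (ae_of_all _ fun _ ↦ gaussianPDF_lt_top)] at h1
    simpa [smul_eq_mul] using h1
  have hd : ∀ x : ℝ, HasDerivAt (fun x => gaussianPDFReal 0 1 x * P.eval x)
      (gaussianPDFReal 0 1 x * (P.derivative - Polynomial.X * P).eval x) x := by
    intro x
    have h1 : HasDerivAt (gaussianPDFReal 0 1) (-x * gaussianPDFReal 0 1 x) x := by
      unfold gaussianPDFReal
      have : HasDerivAt (fun x : ℝ => -(x - 0) ^ 2 / (2 * ((1 : NNReal) : ℝ))) (-x) x := by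
        have := ((((hasDerivAt_id x).sub_const 0).pow 2).neg).div_const (2 * ((1 : NNReal) : ℝ))
        refine this.congr_deriv ?_
        simp
        ring
      have := (this.exp).const_mul (√(2 * Real.pi * ((1 : NNReal) : ℝ)))⁻¹
      refine this.congr_deriv ?_
      ring
    refine (h1.mul (P.hasDerivAt x)).congr_deriv ?_
    simp; ring
  have h0 := integral_eq_zero_of_hasDerivAt_of_integrable hd (hi _) (hi _)
  have e1 := hi P.derivative
  have e2 := hi (Polynomial.X * P)
  rw [integral_gaussianReal_eq_integral_smul one_ne_zero,
    integral_gaussianReal_eq_integral_smul one_ne_zero]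
  simp only [Polynomial.eval_sub, mul_sub] at h0
  rw [integral_sub e1 e2] at h0
  simp only [Polynomial.eval_mul, Polynomial.eval_X] at h0
  simp only [smul_eq_mul]
  linarith

lemma stein_joint {Ω : Type*} {mΩ : MeasurableSpace Ω} (μ : Measure Ω) [IsProbabilityMeasure μ]
    (X Z : Ω → ℝ) (hX : Measurable X) (hZ : Measurable Z)
    (hXl : μ.map X = gaussianReal 0 1) (hXp : ∀ p : NNReal, MemLp X p μ)
    (hZp : ∀ p : NNReal, MemLp Z p μ)
    (hind : IndepFun X Z μ) (c : ℝ) (f g : Polynomial ℝ) :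
    ∫ ω, X ω * f.eval (X ω) * g.eval (c * X ω + Z ω) ∂μ =
      ∫ ω, f.derivative.eval (X ω) * g.eval (c * X ω + Z ω) ∂μ
      + c * ∫ ω, f.eval (X ω) * g.derivative.eval (c * X ω + Z ω) ∂μ := by
  have hY : ∀ p : NNReal, MemLp (fun ω => c * X ω + Z ω) p μ :=
    fun p => ((hXp p).const_mul c).add (hZp p)
  have hint : ∀ f g : Polynomial ℝ,
      Integrable (fun ω => f.eval (X ω) * g.eval (c * X ω + Z ω)) μ := fun f g =>
    memLp_one_iff_integrable.1
      (by simpa using memLp_all_mul (memLp_all_poly hXp f) (memLp_all_poly hY g) 1)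
  have hmap := (indepFun_iff_map_prod_eq_prod_map_map hX.aemeasurable hZ.aemeasurable).1 hind
  rw [hXl] at hmap
  have : IsProbabilityMeasure (μ.map Z) := Measure.isProbabilityMeasure_map hZ.aemeasurable
  have key : ∀ f g : Polynomial ℝ, 
      Integrable (fun p : ℝ × ℝ => f.eval p.1 * g.eval (c * p.1 + p.2)) ((gaussianReal 0 1).prod (μ.map Z)) ∧ ∫ ω, f.eval (X ω) * g.eval (c * X ω + Z ω) ∂μ =
      ∫ z, ∫ x, f.eval x * g.eval (c * x + z) ∂(gaussianReal 0 1) ∂(μ.map Z) := by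
    intro f g
    have hm : AEStronglyMeasurable (fun p : ℝ × ℝ => f.eval p.1 * g.eval (c * p.1 + p.2)) (μ.map (fun ω => (X ω, Z ω))) := by
      apply Continuous.aestronglyMeasurable
      fun_prop
    have hI : Integrable (fun p : ℝ × ℝ => f.eval p.1 * g.eval (c * p.1 + p.2)) ((gaussianReal 0 1).prod (μ.map Z)) := by
      rw [← hmap, integrable_map_measure hm (by fun_prop)]
      exact hint f g
    refine ⟨hI, ?_⟩
    rw [← integral_prod_symm _ hI, ← hmap, integral_map (by fun_prop) hm]
  have k1 := key (Polynomial.X * f) g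
  have k2 := key f.derivative g
  have k3 := key f g.derivative
  simp only [Polynomial.eval_mul, Polynomial.eval_X] at k1
  rw [k1.2, k2.2, k3.2, ← integral_const_mul, ← integral_add k2.1.integral_prod_right (k3.1.integral_prod_right.const_mul c)]
  congr 1
  ext z
  have hP := stein_poly (f * g.comp (Polynomial.C c * Polynomial.X + Polynomial.C z))
  have hgI : ∀ Q : Polynomial ℝ, Integrable (fun x => Q.eval x) (gaussianReal 0 1) :=
    fun Q => memLp_one_iff_integrable.1 (by simpa using gauss_memLp_poly 1 Q 1)
  have i1 := hgI (f.derivative * g.comp (Polynomial.C c * Polynomial.X + Polynomial.C z))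
  have i2 := hgI (f * g.derivative.comp (Polynomial.C c * Polynomial.X + Polynomial.C z))
  simp only [Polynomial.eval_mul, Polynomial.eval_comp, Polynomial.eval_add, Polynomial.eval_C,
    Polynomial.eval_X] at hP i1 i2
  rw [← integral_const_mul, ← integral_add i1 (i2.const_mul c)]
  simp only [mul_assoc]
  rw [hP]
  congr 1
  ext x
  simp [Polynomial.derivative_comp]
  ring

lemma iterate_derivative_hermite (q : ℕ) :
    Polynomial.derivative^[q] ((Polynomial.hermite q).map (Int.castRingHom ℝ)) =
      Polynomial.C (q.factorial : ℝ) := by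
  have hdeg : ((Polynomial.hermite q).map (Int.castRingHom ℝ)).natDegree ≤ q :=
    Polynomial.natDegree_map_le.trans Polynomial.natDegree_hermite.le
  ext n
  rw [Polynomial.coeff_iterate_derivative]
  rcases Nat.eq_zero_or_pos n with rfl | hn
  · simp [Nat.descFactorial_self]
  · rw [Polynomial.coeff_eq_zero_of_natDegree_lt (by omega)]
    rw [Polynomial.coeff_C]
    simp [hn.ne']

lemma hermite_cov {Ω : Type*} {mΩ : MeasurableSpace Ω} (μ : Measure Ω) [IsProbabilityMeasure μ]
    (X Y : Ω → ℝ) (hX : Measurable X) (hY : Measurable Y)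
    (hG : ∀ a b : ℝ, ∃ v : NNReal, μ.map (fun ω => a * X ω + b * Y ω) = gaussianReal 0 v)
    (c : ℝ) (hXX : ∫ ω, X ω * X ω ∂μ = 1) (hXY : ∫ ω, X ω * Y ω ∂μ = c) (q : ℕ) :
    Integrable (fun ω => (Polynomial.aeval (X ω) (Polynomial.hermite q) : ℝ) *
      Polynomial.aeval (Y ω) (Polynomial.hermite q)) μ ∧
    ∫ ω, (Polynomial.aeval (X ω) (Polynomial.hermite q) : ℝ) *
      Polynomial.aeval (Y ω) (Polynomial.hermite q) ∂μ = q.factorial * c ^ q := by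
  have hLp : ∀ a b : ℝ, ∀ p : NNReal, MemLp (fun ω => a * X ω + b * Y ω) p μ := by
    intro a b p
    obtain ⟨v, hv⟩ := hG a b
    have := memLp_id_gaussianReal (μ := 0) (v := v) p
    rw [← hv, memLp_map_measure_iff (by fun_prop) (by fun_prop)] at this
    exact this
  have hmean : ∀ a b : ℝ, ∫ ω, a * X ω + b * Y ω ∂μ = 0 := by
    intro a b
    obtain ⟨v, hv⟩ := hG a b
    have := integral_id_gaussianReal (μ := 0) (v := v)
    rw [← hv, integral_map (by fun_prop) (by fun_prop)] at this
    exact this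
  have hXp : ∀ p : NNReal, MemLp X p μ := fun p => by simpa using hLp 1 0 p
  have hYp : ∀ p : NNReal, MemLp Y p μ := fun p => by simpa using hLp 0 1 p
  have hXm : ∫ ω, X ω ∂μ = 0 := by simpa using hmean 1 0
  have hXl : μ.map X = gaussianReal 0 1 := by
    obtain ⟨v, hv⟩ := hG 1 0
    simp only [one_mul, zero_mul, add_zero] at hv
    have h1 := variance_fun_id_gaussianReal (μ := 0) (v := v)
    rw [← hv, variance_map (by fun_prop) (by fun_prop), variance_of_integral_eq_zero (by fun_prop) (by simpa using hXm)] at h1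
    have : v = 1 := by
      apply NNReal.coe_injective
      rw [← h1]
      simpa [pow_two] using hXX
    rw [← this]; exact hv
  set Z : Ω → ℝ := fun ω => Y ω - c * X ω with hZdef
  have hZ : Measurable Z := by fun_prop
  have hZp : ∀ p : NNReal, MemLp Z p μ := fun p => (hYp p).sub ((hXp p).const_mul c)
  have hXX' : Integrable (fun ω => X ω * X ω) μ :=
    memLp_one_iff_integrable.1 (by simpa using memLp_all_mul hXp hXp 1)
  have hXY' : Integrable (fun ω => X ω * Y ω) μ :=
    memLp_one_iff_integrable.1 (by simpa using memLp_all_mul hXp hYp 1)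
  have hind : IndepFun X Z μ := by
    apply HasGaussianLaw.indepFun_of_covariance_eq_zero
    · constructor
      apply isGaussian_of_map_eq_gaussianReal
      intro L
      rw [Measure.map_map (by fun_prop) (by fun_prop)]
      obtain ⟨v, hv⟩ := hG (L (1, 0) - c * L (0, 1)) (L (0, 1))
      refine ⟨0, v, ?_⟩
      rw [← hv]
      congr 1
      ext ω
      have : ((X ω, Z ω) : ℝ × ℝ) = X ω • (1, 0) + Z ω • (0, 1) := by simp
      simp only [Function.comp_apply]
      rw [this, map_add, map_smul, map_smul]
      simp [hZdef]; ring
    · rw [covariance_eq_sub (by simpa using hXp 2) (by simpa using hZp 2), hXm]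
      simp only [Pi.mul_apply, hZdef, zero_mul, sub_zero]
      have : ∀ ω, X ω * (Y ω - c * X ω) = X ω * Y ω - c * (X ω * X ω) := fun ω => by ring
      simp only [this]
      rw [integral_sub hXY' (hXX'.const_mul c), integral_const_mul, hXX, hXY]
      ring
  have hae : ∀ (n : ℕ) (x : ℝ), (Polynomial.aeval x (Polynomial.hermite n) : ℝ) =
      ((Polynomial.hermite n).map (Int.castRingHom ℝ)).eval x := by
    intro n x
    rw [Polynomial.eval_map, Polynomial.aeval_def]; rfl
  simp only [hae]
  have hint : ∀ f g : Polynomial ℝ,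
      Integrable (fun ω => f.eval (X ω) * g.eval (Y ω)) μ := fun f g =>
    memLp_one_iff_integrable.1
      (by simpa using memLp_all_mul (memLp_all_poly hXp f) (memLp_all_poly hYp g) 1)
  refine ⟨hint _ _, ?_⟩
  have main : ∀ (n : ℕ) (g : Polynomial ℝ),
      ∫ ω, ((Polynomial.hermite n).map (Int.castRingHom ℝ)).eval (X ω) * g.eval (Y ω) ∂μ =
        c ^ n * ∫ ω, (Polynomial.derivative^[n] g).eval (Y ω) ∂μ := by
    intro n
    induction n with
    | zero => intro g; simp
    | succ n ih =>
      intro g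
      set f := (Polynomial.hermite n).map (Int.castRingHom ℝ) with hf
      have hst := stein_joint μ X Z hX hZ hXl hXp hZp hind c f g
      have hYe : ∀ ω, c * X ω + Z ω = Y ω := fun ω => by simp [hZdef]
      simp only [hYe] at hst
      rw [Polynomial.hermite_succ]
      have e : ∀ ω, ((Polynomial.X * Polynomial.hermite n - Polynomial.derivative (Polynomial.hermite n)).map (Int.castRingHom ℝ)).eval (X ω) * g.eval (Y ω)
        = X ω * f.eval (X ω) * g.eval (Y ω) - f.derivative.eval (X ω) * g.eval (Y ω) := by
        intro ω
        simp [hf, Polynomial.derivative_map]; ring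
      simp only [e]
      have h1 := hint (Polynomial.X * f) g
      simp only [Polynomial.eval_mul, Polynomial.eval_X] at h1
      rw [integral_sub h1 (hint _ _), hst, ih, Function.iterate_succ_apply]
      ring
  rw [main, iterate_derivative_hermite]
  simp
  ring

lemma second_diff (a : ℝ) (ha : 0 < a) (r : ℝ) (hr : 1 ≤ r) :
    ∃ η : ℝ, r - 1 < η ∧ η < r + 1 ∧
      (r + 1) ^ a + (r - 1) ^ a - 2 * r ^ a = a * (a - 1) * η ^ (a - 2) := by
  obtain ⟨ξ, hξ, h1⟩ := exists_hasDerivAt_eq_slope (fun x : ℝ => (x + 1) ^ a - x ^ a)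
    (fun x => a * (x + 1) ^ (a - 1) - a * x ^ (a - 1)) (show r - 1 < r by linarith)
    (by
      apply ContinuousOn.sub
      · exact ((continuous_id.add continuous_const).rpow_const (fun _ => Or.inr ha.le)).continuousOn
      · exact (continuous_id.rpow_const (fun _ => Or.inr ha.le)).continuousOn)
    (by
      intro x hx
      have hx0 : 0 < x := by linarith [hx.1]
      refine HasDerivAt.sub ?_ ?_
      · refine (((hasDerivAt_id x).add_const 1).rpow_const (p := a) (Or.inl ?_)).congr_deriv ?_
        · simp; linarith
        · simp
      · exact Real.hasDerivAt_rpow_const (Or.inl hx0.ne'))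
  have hξ0 : 0 < ξ := by linarith [hξ.1]
  obtain ⟨η, hη, h2⟩ := exists_hasDerivAt_eq_slope (fun x : ℝ => a * x ^ (a - 1))
    (fun x => a * ((a - 1) * x ^ (a - 1 - 1))) (show ξ < ξ + 1 by linarith)
    (by
      apply ContinuousOn.mul continuousOn_const
      intro x hx
      exact (Real.continuousAt_rpow_const x _ (Or.inl (by linarith [hx.1]))).continuousWithinAt)
    (by
      intro x hx
      exact (Real.hasDerivAt_rpow_const (Or.inl (by linarith [hx.1]))).const_mul a)
  refine ⟨η, by linarith [hη.1, hξ.1], by linarith [hη.2, hξ.2], ?_⟩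
  have e : a - 1 - 1 = a - 2 := by ring
  simp only [e] at h2
  have e1 : r - 1 + 1 = r := by ring
  simp only [e1, sub_sub_cancel, div_one, add_sub_cancel_left] at h1 h2
  linarith

/-- sum over the square as iterated partial sums -/
lemma sq_sum (g : ℤ → ℝ) (n : ℕ) :
    ∑ k ∈ Finset.range n, ∑ l ∈ Finset.range n, g ((k : ℤ) - l) =
      ∑ m ∈ Finset.range n, (g 0 + ∑ j ∈ Finset.range m, (g ((j : ℤ) + 1) + g (-((j : ℤ) + 1)))) := by
  induction n with
  | zero => simp
  | succ n ih =>
    rw [Finset.sum_range_succ _ n, Finset.sum_range_succ _ n]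
    simp only [Finset.sum_range_succ _ n]
    rw [Finset.sum_add_distrib, ih, Finset.sum_add_distrib]
    have h1 : ∑ j ∈ Finset.range n, g ((j : ℤ) + 1) = ∑ j ∈ Finset.range n, g ((n : ℤ) - j) := by
      rw [← Finset.sum_range_reflect]
      refine Finset.sum_congr rfl fun j hj => ?_
      have := Finset.mem_range.1 hj
      congr 1; omega
    have h2 : ∑ j ∈ Finset.range n, g (-((j : ℤ) + 1)) = ∑ j ∈ Finset.range n, g ((j : ℤ) - n) := by
      rw [← Finset.sum_range_reflect]
      refine Finset.sum_congr rfl fun j hj => ?_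
      have := Finset.mem_range.1 hj
      congr 1; omega
    have h3 := Finset.sum_add_distrib (s := Finset.range n) (f := fun j : ℕ => g ((j : ℤ) + 1))
      (g := fun j : ℕ => g (-((j : ℤ) + 1)))
    rw [h1, h2] at h3
    rw [h3, sub_self]
    ring

lemma hasSum_int_sym (g : ℤ → ℝ) (hs : ∀ r, g (-r) = g r)
    (hg : Summable fun j : ℕ => g ((j : ℤ) + 1)) :
    HasSum g (g 0 + 2 * ∑' j : ℕ, g ((j : ℤ) + 1)) := by
  have h1 : HasSum (fun n : ℕ => g n) (g 0 + ∑' j : ℕ, g ((j : ℤ) + 1)) := by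
    have : HasSum (fun n : ℕ => g ((n + 1 : ℕ) : ℤ)) (∑' j : ℕ, g ((j : ℤ) + 1)) := by
      simpa using hg.hasSum
    have := (hasSum_nat_add_iff (f := fun n : ℕ => g n) 1).1 this
    simpa [add_comm] using this
  have h2 : HasSum (fun n : ℕ => g (-((n : ℤ) + 1))) (∑' j : ℕ, g ((j : ℤ) + 1)) := by
    simpa only [hs] using hg.hasSum
  have := HasSum.of_nat_of_neg_add_one h1 h2
  convert this using 1
  ring

lemma cesaro_sq (g : ℤ → ℝ) (hs : ∀ r, g (-r) = g r)
    (hg : Summable fun j : ℕ => g ((j : ℤ) + 1)) :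
    Tendsto (fun n : ℕ => (∑ k ∈ Finset.range n, ∑ l ∈ Finset.range n, g ((k : ℤ) - l)) / (n : ℝ))
      atTop (𝓝 (∑' r, g r)) := by
  rw [(hasSum_int_sym g hs hg).tsum_eq]
  have h : Tendsto (fun m : ℕ => g 0 + ∑ j ∈ Finset.range m, (g ((j : ℤ) + 1) + g (-((j : ℤ) + 1))))
      atTop (𝓝 (g 0 + 2 * ∑' j : ℕ, g ((j : ℤ) + 1))) := by
    apply Tendsto.const_add
    have := (hg.hasSum.mul_left 2).tendsto_sum_nat
    simpa only [hs, ← two_mul] using this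
  have := h.cesaro
  simp only [sq_sum]
  refine this.congr fun n => ?_
  rw [div_eq_inv_mul]

lemma rho_part (q : ℕ) (hq : 2 ≤ q)
    (H : ℝ) (hH0 : 0 < H) (hH1 : H < 1 - 1 / (2 * (q : ℝ)))
    (ρ : ℤ → ℝ)
    (hρ : ∀ r : ℤ, ρ r =
      (1 / 2 : ℝ) * (|(r : ℝ) + 1| ^ (2 * H) + |(r : ℝ) - 1| ^ (2 * H) - 2 * |(r : ℝ)| ^ (2 * H))) :
    ρ 0 = 1 ∧ (∀ r, ρ (-r) = ρ r) ∧ (Summable fun j : ℕ => ρ ((j : ℤ) + 1) ^ q) ∧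
      0 < 1 + 2 * ∑' j : ℕ, ρ ((j : ℤ) + 1) ^ q := by
  have hq0 : (0 : ℝ) < q := by positivity
  have hqH : (q : ℝ) * (2 * H - 2) < -1 := by
    have : (q : ℝ) * (1 / (2 * q)) = 1 / 2 := by field_simp
    nlinarith
  have hH2 : 2 * H < 2 := by nlinarith
  have h0 : ρ 0 = 1 := by
    rw [hρ]
    simp [Real.zero_rpow (by positivity : 2 * H ≠ 0)]
    norm_num
  have hsym : ∀ r, ρ (-r) = ρ r := by
    intro r
    rw [hρ, hρ]
    push_cast
    rw [show (-(r : ℝ) + 1) = -(r - 1) by ring, show (-(r : ℝ) - 1) = -(r + 1) by ring]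
    simp only [abs_neg]
    ring
  have hpos : ∀ j : ℕ, ρ ((j : ℤ) + 1) = (1 / 2 : ℝ) *
      (((j : ℝ) + 1 + 1) ^ (2 * H) + (j : ℝ) ^ (2 * H) - 2 * ((j : ℝ) + 1) ^ (2 * H)) := by
    intro j
    rw [hρ]
    push_cast
    rw [abs_of_nonneg (by positivity), abs_of_nonneg (by simp), abs_of_nonneg (by positivity)]
    simp
  have hmv : ∀ j : ℕ, ∃ η : ℝ, (j : ℝ) < η ∧
      ρ ((j : ℤ) + 1) = (1 / 2 : ℝ) * (2 * H * (2 * H - 1) * η ^ (2 * H - 2)) := by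
    intro j
    obtain ⟨η, h1, -, h3⟩ := second_diff (2 * H) (by positivity) ((j : ℝ) + 1) (by simp)
    refine ⟨η, by simpa using h1, ?_⟩
    rw [hpos, ← h3]
    simp
  have hsum : Summable fun j : ℕ => ρ ((j : ℤ) + 1) ^ q := by
    rw [← summable_nat_add_iff 1]
    have hs := (Real.summable_nat_rpow.2 hqH)
    rw [← summable_nat_add_iff 1] at hs
    refine Summable.of_norm_bounded (hs.mul_left (|(1 / 2 : ℝ) * (2 * H * (2 * H - 1))| ^ q)) ?_
    intro j
    obtain ⟨η, h1, h2⟩ := hmv (j + 1)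
    rw [h2, norm_pow, mul_comm (q : ℝ), Real.rpow_mul_natCast (by positivity), ← mul_pow]
    have hj : (0 : ℝ) < ((j + 1 : ℕ) : ℝ) := by positivity
    have hη : 0 < η := hj.trans h1
    gcongr
    rw [← mul_assoc, norm_mul, Real.norm_eq_abs, Real.norm_eq_abs, abs_of_pos (Real.rpow_pos_of_pos hη _)]
    exact mul_le_mul_of_nonneg_left (Real.rpow_le_rpow_of_nonpos hj h1.le (by linarith))
      (abs_nonneg _)
  refine ⟨h0, hsym, hsum, ?_⟩
  have hη0 : ∀ j : ℕ, ∃ y : ℝ, 0 < y ∧ ρ ((j : ℤ) + 1) = y * (2 * H - 1) := by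
    intro j
    obtain ⟨η, h1, h2⟩ := hmv j
    have hη : 0 < η := lt_of_le_of_lt (by positivity) h1
    exact ⟨H * η ^ (2 * H - 2), by positivity, by rw [h2]; ring⟩
  rcases le_total (1 / 2) H with hH | hH
  · have : 0 ≤ ∑' j : ℕ, ρ ((j : ℤ) + 1) ^ q := by
      apply tsum_nonneg
      intro j
      apply pow_nonneg
      obtain ⟨y, hy, h⟩ := hη0 j
      rw [h]
      exact mul_nonneg hy.le (by linarith)
    linarith
  · have hneg : ∀ j : ℕ, 0 ≤ -ρ ((j : ℤ) + 1) := by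
      intro j
      obtain ⟨y, hy, h⟩ := hη0 j
      rw [h]
      nlinarith
    have htel : ∀ N : ℕ, ∑ j ∈ Finset.range N, -ρ ((j : ℤ) + 1) =
        (1 / 2 : ℝ) * (1 - (((N : ℝ) + 1) ^ (2 * H) - (N : ℝ) ^ (2 * H))) := by
      intro N
      induction N with
      | zero => simp [Real.zero_rpow (by positivity : 2 * H ≠ 0)]
      | succ N ih =>
        rw [Finset.sum_range_succ, ih, hpos]
        push_cast
        ring
    have hle : ∀ N : ℕ, ∑ j ∈ Finset.range N, -ρ ((j : ℤ) + 1) ≤ 1 / 2 := by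
      intro N
      rw [htel]
      have : (N : ℝ) ^ (2 * H) ≤ ((N : ℝ) + 1) ^ (2 * H) :=
        Real.rpow_le_rpow (by positivity) (by linarith) (by positivity)
      linarith
    have hone : ∀ j : ℕ, -ρ ((j : ℤ) + 1) ≤ 1 / 2 := fun j =>
      (Finset.single_le_sum (f := fun j : ℕ => -ρ ((j : ℤ) + 1)) (fun i _ => hneg i)
        (Finset.self_mem_range_succ j)).trans (hle (j + 1))
    have hb : ∀ j : ℕ, -(ρ ((j : ℤ) + 1) ^ q) ≤ (1 / 2) * -ρ ((j : ℤ) + 1) := by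
      intro j
      have hx := hneg j
      have hx1 := hone j
      set x := -ρ ((j : ℤ) + 1) with hxd
      have hr : ρ ((j : ℤ) + 1) = -x := by simp [hxd]
      rw [hr]
      calc -((-x) ^ q) ≤ |(-x) ^ q| := neg_le_abs _
        _ = x ^ q := by rw [abs_pow, abs_neg, abs_of_nonneg hx]
        _ ≤ x ^ 2 := pow_le_pow_of_le_one hx (by linarith) hq
        _ ≤ 1 / 2 * x := by nlinarith
    have : ∑' j : ℕ, -(ρ ((j : ℤ) + 1) ^ q) ≤ 1 / 4 := by
      apply le_of_tendsto' hsum.neg.hasSum.tendsto_sum_nat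
      intro N
      calc _ ≤ ∑ j ∈ Finset.range N, (1 / 2) * -ρ ((j : ℤ) + 1) := Finset.sum_le_sum fun j _ => hb j
        _ = 1 / 2 * ∑ j ∈ Finset.range N, -ρ ((j : ℤ) + 1) := by rw [Finset.mul_sum]
        _ ≤ 1 / 4 := by linarith [hle N]
    rw [tsum_neg] at this
    linarith

/-- For `q ≥ 2`, `H ∈ (0, 1 − 1/(2q))` and a discrete fBm `(B_k)` with Hurst index `H`,
setting `V_n = Σ_{k=0}^{n−1} H_q(B_{k+1} − B_k)`, one has
`E[V_n²]/n → q! Σ_{r∈ℤ} ρ_H(r)^q`, a finite positive real number. -/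
theorem stmt11
    {Ω : Type*} {mΩ : MeasurableSpace Ω} (μ : Measure Ω) [IsProbabilityMeasure μ]
    (q : ℕ) (hq : 2 ≤ q)
    (H : ℝ) (hH0 : 0 < H) (hH1 : H < 1 - 1 / (2 * (q : ℝ)))
    (B : ℕ → Ω → ℝ) (hBmeas : ∀ k, Measurable (B k))
    -- every finite real-linear combination of the `B_k` is centered Gaussian
    (hGauss : ∀ (s : Finset ℕ) (a : ℕ → ℝ), ∃ v : NNReal,
      Measure.map (fun ω => ∑ i ∈ s, a i * B i ω) μ = gaussianReal 0 v)
    -- fBm covariance structure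
    (hcov : ∀ k l : ℕ, ∫ ω, B k ω * B l ω ∂μ =
      (1 / 2 : ℝ) * ((k : ℝ) ^ (2 * H) + (l : ℝ) ^ (2 * H) - |(k : ℝ) - (l : ℝ)| ^ (2 * H)))
    -- covariance function of fractional Gaussian noise
    (ρ : ℤ → ℝ)
    (hρ : ∀ r : ℤ, ρ r =
      (1 / 2 : ℝ) * (|(r : ℝ) + 1| ^ (2 * H) + |(r : ℝ) - 1| ^ (2 * H) - 2 * |(r : ℝ)| ^ (2 * H)))
    -- Hermite power variation
    (V : ℕ → Ω → ℝ)
    (hV : ∀ n ω, V n ω =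
      ∑ k ∈ Finset.range n, (Polynomial.aeval (B (k + 1) ω - B k ω) (Polynomial.hermite q) : ℝ)) :
    Summable (fun r : ℤ => ρ r ^ q) ∧
    0 < (q.factorial : ℝ) * ∑' r : ℤ, ρ r ^ q ∧
    Tendsto (fun n : ℕ => (∫ ω, (V n ω) ^ 2 ∂μ) / (n : ℝ)) atTop
      (𝓝 ((q.factorial : ℝ) * ∑' r : ℤ, ρ r ^ q)) := by
  obtain ⟨h0, hsym, hsum, hpos⟩ := rho_part q hq H hH0 hH1 ρ hρ
  have hsymq : ∀ r, ρ (-r) ^ q = ρ r ^ q := fun r => by rw [hsym]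
  have hS := hasSum_int_sym (fun r => ρ r ^ q) hsymq hsum
  refine ⟨hS.summable, ?_, ?_⟩
  · rw [hS.tsum_eq]
    simp only [h0, one_pow]
    positivity
  have hBp : ∀ k, ∀ p : NNReal, MemLp (B k) p μ := by
    intro k p
    obtain ⟨v, hv⟩ := hGauss {k} (fun _ => 1)
    simp only [Finset.sum_singleton, one_mul] at hv
    have := memLp_id_gaussianReal (μ := 0) (v := v) p
    rw [← hv, memLp_map_measure_iff (by fun_prop) (by fun_prop)] at this
    exact this
  have hBI : ∀ k l, Integrable (fun ω => B k ω * B l ω) μ := fun k l =>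
    memLp_one_iff_integrable.1 (by simpa using memLp_all_mul (hBp k) (hBp l) 1)
  have hc : ∀ k l : ℕ, ∫ ω, (B (k + 1) ω - B k ω) * (B (l + 1) ω - B l ω) ∂μ = ρ ((k : ℤ) - l) := by
    intro k l
    have e : ∀ ω, (B (k + 1) ω - B k ω) * (B (l + 1) ω - B l ω) =
      (B (k + 1) ω * B (l + 1) ω - B (k + 1) ω * B l ω) - (B k ω * B (l + 1) ω - B k ω * B l ω) :=
      fun ω => by ring
    simp only [e]
    have hD : ∀ i j m p : ℕ, Integrable (fun ω => B i ω * B j ω - B m ω * B p ω) μ :=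
      fun i j m p => (hBI i j).sub (hBI m p)
    rw [integral_sub (hD _ _ _ _) (hD _ _ _ _),
      integral_sub (hBI _ _) (hBI _ _), integral_sub (hBI _ _) (hBI _ _), hcov, hcov, hcov, hcov, hρ]
    push_cast
    rw [show ((k : ℝ) + 1 - (l + 1)) = k - l by ring, show ((k : ℝ) - (l + 1)) = k - l - 1 by ring,
      show ((k : ℝ) + 1 - l) = k - l + 1 by ring]
    ring
  have hG : ∀ k l : ℕ, ∀ a b : ℝ, ∃ v : NNReal, μ.map (fun ω => a * (B (k + 1) ω - B k ω) +
      b * (B (l + 1) ω - B l ω)) = gaussianReal 0 v := by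
    intro k l a b
    obtain ⟨v, hv⟩ := hGauss (Finset.range (k + l + 2)) (fun i =>
      a * ((if i = k + 1 then 1 else 0) - (if i = k then 1 else 0)) +
      b * ((if i = l + 1 then 1 else 0) - (if i = l then 1 else 0)))
    refine ⟨v, ?_⟩
    rw [← hv]
    congr 1
    ext ω
    simp only [add_mul, mul_assoc, sub_mul, Finset.sum_add_distrib, ← Finset.mul_sum,
      Finset.sum_sub_distrib, ite_mul, one_mul, zero_mul, Finset.sum_ite_eq', Finset.mem_range]
    rw [if_pos (by omega), if_pos (by omega), if_pos (by omega), if_pos (by omega)]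
  have hm := fun k l : ℕ => hermite_cov μ (fun ω => B (k + 1) ω - B k ω)
    (fun ω => B (l + 1) ω - B l ω) ((hBmeas _).sub (hBmeas _)) ((hBmeas _).sub (hBmeas _))
    (hG k l) (ρ ((k : ℤ) - l)) (by rw [hc, sub_self, h0]) (hc k l) q
  have hV2 : ∀ n, ∫ ω, (V n ω) ^ 2 ∂μ = (q.factorial : ℝ) *
      ∑ k ∈ Finset.range n, ∑ l ∈ Finset.range n, ρ ((k : ℤ) - l) ^ q := by
    intro n
    simp only [hV, pow_two, Finset.sum_mul_sum]
    rw [integral_finsetSum _ fun k _ => integrable_finsetSum _ fun l _ => (hm k l).1, Finset.mul_sum]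
    refine Finset.sum_congr rfl fun k _ => ?_
    rw [integral_finsetSum _ fun l _ => (hm k l).1, Finset.mul_sum]
    exact Finset.sum_congr rfl fun l _ => (hm k l).2
  have := (cesaro_sq (fun r => ρ r ^ q) hsymq hsum).const_mul (q.factorial : ℝ)
  refine this.congr fun n => ?_
  rw [hV2, mul_div_assoc]
end
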